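/- arXiv:math/0703606 — 2 statements merged into one kernel-verified Lean document; each statement's English description precedes it below -/
import Mathlib

section
/- For every Schwartz function φ on ℝ³, ∫_{ℝ³} |x| · Δ(Δφ)(x) dx = −8π φ(0). In other words, the bi-Laplacian of the function x ↦ |x| on ℝ³, taken in the sense of tempered distributions, equals −8π times the Dirac delta at the origin. -/
open MeasureTheory Real Complex
open scoped FourierTransform ENNReal ContDiff

noncomputable section

/-- The `j`-th partial derivative of a function on `EuclideanSpace ℝ (Fin n)`. -/
def pd {n : ℕ} {F : Type*} [NormedAddCommGroup F] [NormedSpace ℝ F]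
    (j : Fin n) (f : EuclideanSpace ℝ (Fin n) → F) (x : EuclideanSpace ℝ (Fin n)) : F :=
  fderiv ℝ f x (EuclideanSpace.single j 1)

/-- The Laplacian. -/
def lap {n : ℕ} {F : Type*} [NormedAddCommGroup F] [NormedSpace ℝ F]
    (f : EuclideanSpace ℝ (Fin n) → F) (x : EuclideanSpace ℝ (Fin n)) : F :=
  ∑ j, pd j (pd j f) x

/-- `f` coincides with a (complex-valued) Schwartz function. -/
def IsSchwartz {n : ℕ} (f : EuclideanSpace ℝ (Fin n) → ℂ) : Prop :=
  ∃ g : SchwartzMap (EuclideanSpace ℝ (Fin n)) ℂ, ⇑g = f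

/-- `f` coincides with a (real-valued) Schwartz function. -/
def IsSchwartzR {n : ℕ} (f : EuclideanSpace ℝ (Fin n) → ℝ) : Prop :=
  ∃ g : SchwartzMap (EuclideanSpace ℝ (Fin n)) ℝ, ⇑g = f

/-- A (smooth, spatially Schwartz) solution of the defocusing cubic NLS
`i ∂ₜ u + Δ u = |u|² u` on `[0,T] × ℝⁿ`. -/
def IsNLSSolution (n : ℕ) (T : ℝ) (u : ℝ → EuclideanSpace ℝ (Fin n) → ℂ) : Prop :=
  ContDiff ℝ ∞ (Function.uncurry u) ∧
  (∀ t ∈ Set.Icc (0:ℝ) T, IsSchwartz (u t)) ∧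
  (∀ t ∈ Set.Icc (0:ℝ) T, ∀ x, Complex.I * deriv (fun s => u s x) t + lap (u t) x
      = (‖u t x‖ : ℂ)^2 * u t x)

/-- Inhomogeneous Sobolev norm via the Fourier transform. -/
def HsNorm {n : ℕ} (σ : ℝ) (f : EuclideanSpace ℝ (Fin n) → ℂ) : ℝ :=
  (∫ ξ, (1 + ‖ξ‖) ^ (2 * σ) * ‖𝓕 f ξ‖ ^ 2) ^ ((1:ℝ)/2)

/-- Homogeneous Sobolev norm via the Fourier transform. -/
def HdotNorm {n : ℕ} (σ : ℝ) (f : EuclideanSpace ℝ (Fin n) → ℂ) : ℝ :=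
  (∫ ξ, ‖ξ‖ ^ (2 * σ) * ‖𝓕 f ξ‖ ^ 2) ^ ((1:ℝ)/2)

/-- The Fourier multiplier operator with (real) symbol `m`. -/
def fourierMult {n : ℕ} (m : EuclideanSpace ℝ (Fin n) → ℝ) (f : EuclideanSpace ℝ (Fin n) → ℂ) :
    EuclideanSpace ℝ (Fin n) → ℂ :=
  𝓕⁻ (fun ξ => (m ξ : ℂ) * 𝓕 f ξ)

/-- The standing hypotheses on the radial profile `φ` of the symbol of the smoothing
operator `I = I_N`, with derivative-bound constants `Ck` (independent of `N`). -/
structure IMultiplier (s N : ℝ) (Ck : ℕ → ℝ) (φ : ℝ → ℝ) : Prop where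
  contDiff : ContDiffOn ℝ ∞ φ (Set.Ioi 0)
  pos : ∀ r > (0:ℝ), 0 < φ r
  le_one : ∀ r > (0:ℝ), φ r ≤ 1
  anti : AntitoneOn φ (Set.Ioi 0)
  eq_one : ∀ r : ℝ, 0 < r → r ≤ N → φ r = 1
  eq_pow : ∀ r : ℝ, 2 * N ≤ r → φ r = (r / N) ^ (s - 1)
  mono_mul : MonotoneOn (fun r => r * φ r) (Set.Ioi 0)
  deriv_bound : ∀ k : ℕ, 1 ≤ k → ∀ r > (0:ℝ), |iteratedDeriv k φ r| ≤ Ck k * φ r * r ^ (-(k:ℝ))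

/-- The smoothing operator `I = I_N`, a Fourier multiplier with symbol `φ (|ξ|)`. -/
def Iop {n : ℕ} (φ : ℝ → ℝ) (f : EuclideanSpace ℝ (Fin n) → ℂ) : EuclideanSpace ℝ (Fin n) → ℂ :=
  fourierMult (fun ξ => φ ‖ξ‖) f

/-- The operator `⟨D⟩ I_N`, a Fourier multiplier with symbol `(1 + |ξ|) φ (|ξ|)`. -/
def DIop {n : ℕ} (φ : ℝ → ℝ) (f : EuclideanSpace ℝ (Fin n) → ℂ) : EuclideanSpace ℝ (Fin n) → ℂ :=
  fourierMult (fun ξ => (1 + ‖ξ‖) * φ ‖ξ‖) f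

/-- Mixed space-time norm `‖v‖_{L^q_{[0,T]} L^r_x}` (with values in `ℝ≥0∞`). -/
def mixNorm {α : Type*} [MeasureSpace α] {F : Type*} [NormedAddCommGroup F]
    (T : ℝ) (q r : ℝ≥0∞) (v : ℝ → α → F) : ℝ≥0∞ :=
  eLpNorm (fun t => (eLpNorm (v t) r volume).toReal) q (volume.restrict (Set.Ioc 0 T))

/-- An admissible pair in `ℝ²`: `1/q + 1/r = 1/2` and `2 < q ≤ ∞`. -/
def Admissible (q r : ℝ≥0∞) : Prop := 1/q + 1/r = 1/2 ∧ 2 < q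

/-- The `L²` norm. -/
def L2Norm {n : ℕ} (f : EuclideanSpace ℝ (Fin n) → ℂ) : ℝ :=
  (∫ x, ‖f x‖ ^ 2) ^ ((1:ℝ)/2)

/-- The `L²` norm of the (spatial) gradient. -/
def gradL2Norm {n : ℕ} (f : EuclideanSpace ℝ (Fin n) → ℂ) : ℝ :=
  (∫ x, ∑ j, ‖pd j f x‖ ^ 2) ^ ((1:ℝ)/2)

/-- Space-time `L⁴_{[0,T]} L⁴_x` norm (real-valued). -/
def L4L4Norm {n : ℕ} (T : ℝ) (v : ℝ → EuclideanSpace ℝ (Fin n) → ℂ) : ℝ :=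
  (∫ t in Set.Ioc (0:ℝ) T, ∫ x, ‖v t x‖ ^ 4) ^ ((1:ℝ)/4)

/-- The modified energy `E(v) = ½∫|∇v|² + ¼∫|v|⁴`. -/
def energy {n : ℕ} (v : EuclideanSpace ℝ (Fin n) → ℂ) : ℝ :=
  (1/2) * (∫ x, ∑ j, ‖pd j v x‖ ^ 2) + (1/4) * ∫ x, ‖v x‖ ^ 4

/-- The Morawetz action `M_a(t) = 2 ∫ ∇a · Im (ū ∇u) dx`. -/
def morAction {n : ℕ} (a : EuclideanSpace ℝ (Fin n) → ℝ)
    (u : ℝ → EuclideanSpace ℝ (Fin n) → ℂ) (t : ℝ) : ℝ :=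
  2 * ∫ x, ∑ j, pd j a x * ((starRingEnd ℂ) (u t x) * pd j (u t) x).im

/-- All derivatives of `a` grow at most polynomially. -/
def PolyGrowth {n : ℕ} (a : EuclideanSpace ℝ (Fin n) → ℝ) : Prop :=
  ∀ k : ℕ, ∃ C d : ℝ, ∀ x, ‖iteratedFDeriv ℝ k a x‖ ≤ C * (1 + ‖x‖) ^ d

/-- The Fréchet derivative of a function of temperate growth is of temperate growth. -/
lemma Function.HasTemperateGrowth.fderiv {E F : Type*} [NormedAddCommGroup E] [NormedSpace ℝ E]
    [NormedAddCommGroup F] [NormedSpace ℝ F] {f : E → F} (hf : f.HasTemperateGrowth) :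
    (fderiv ℝ f).HasTemperateGrowth := by
  refine ⟨hf.1.fderiv_right (m := ∞) (by simp), fun n ↦ ?_⟩
  obtain ⟨k, C, h⟩ := hf.2 (n + 1)
  exact ⟨k, C, fun x ↦ by simpa [norm_iteratedFDeriv_fderiv] using h x⟩

section PartialDerivatives

variable {n : ℕ} {F : Type*} [NormedAddCommGroup F] [NormedSpace ℝ F]

lemma hasTemperateGrowth_pd {f : EuclideanSpace ℝ (Fin n) → F} (hf : f.HasTemperateGrowth)
    (j : Fin n) : (pd j f).HasTemperateGrowth :=
  (ContinuousLinearMap.apply ℝ F (EuclideanSpace.single j (1 : ℝ))).hasTemperateGrowth.comp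
    hf.fderiv

lemma hasTemperateGrowth_lap {f : EuclideanSpace ℝ (Fin n) → F} (hf : f.HasTemperateGrowth) :
    (lap f).HasTemperateGrowth :=
  .sum fun j _ ↦ hasTemperateGrowth_pd (hasTemperateGrowth_pd hf j) j

/-- The partial derivative of a Schwartz function, as a Schwartz function. -/
def schwartzPd (j : Fin n) (g : SchwartzMap (EuclideanSpace ℝ (Fin n)) F) :
    SchwartzMap (EuclideanSpace ℝ (Fin n)) F :=
  LineDeriv.lineDerivOp (EuclideanSpace.single j (1 : ℝ)) g

lemma coe_schwartzPd (j : Fin n) (g : SchwartzMap (EuclideanSpace ℝ (Fin n)) F) :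
    ⇑(schwartzPd j g) = pd j g := rfl

/-- The Laplacian of a Schwartz function, as a Schwartz function. -/
def schwartzLap (g : SchwartzMap (EuclideanSpace ℝ (Fin n)) F) :
    SchwartzMap (EuclideanSpace ℝ (Fin n)) F :=
  ∑ j, schwartzPd j (schwartzPd j g)

lemma coe_schwartzLap (g : SchwartzMap (EuclideanSpace ℝ (Fin n)) F) :
    ⇑(schwartzLap g) = lap g := by
  ext x
  simp [schwartzLap, lap, coe_schwartzPd]

lemma integrable_smul_schwartz {f : EuclideanSpace ℝ (Fin n) → ℝ} (hf : f.HasTemperateGrowth)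
    (g : SchwartzMap (EuclideanSpace ℝ (Fin n)) F) : Integrable fun x ↦ f x • g x := by
  simpa only [SchwartzMap.smulLeftCLM_apply hf] using
    (SchwartzMap.smulLeftCLM F f g).integrable (μ := volume)

lemma integral_smul_pd {f : EuclideanSpace ℝ (Fin n) → ℝ} (hf : f.HasTemperateGrowth)
    (g : SchwartzMap (EuclideanSpace ℝ (Fin n)) F) (j : Fin n) :
    ∫ x, f x • pd j g x = -∫ x, pd j f x • g x :=
  integral_smul_fderiv_eq_neg_fderiv_smul_of_integrable
    (integrable_smul_schwartz (hasTemperateGrowth_pd hf j) g)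
    (integrable_smul_schwartz hf (schwartzPd j g)) (integrable_smul_schwartz hf g)
    (fun _ _ ↦ hf.1.contDiffAt.differentiableAt (by simp)) (fun _ _ ↦ g.differentiableAt)

/-- Green's identity for a function of temperate growth and a Schwartz function. -/
lemma integral_smul_lap {f : EuclideanSpace ℝ (Fin n) → ℝ} (hf : f.HasTemperateGrowth)
    (g : SchwartzMap (EuclideanSpace ℝ (Fin n)) F) :
    ∫ x, f x • lap g x = ∫ x, lap f x • g x := by
  simp only [lap, Finset.smul_sum, Finset.sum_smul]
  rw [integral_finsetSum, integral_finsetSum]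
  · refine Finset.sum_congr rfl fun j _ ↦ ?_
    have h₁ := integral_smul_pd hf (schwartzPd j g) j
    have h₂ := integral_smul_pd (hasTemperateGrowth_pd hf j) g j
    rw [coe_schwartzPd] at h₁
    rw [h₁, h₂, neg_neg]
  · exact fun j _ ↦ integrable_smul_schwartz
      (hasTemperateGrowth_pd (hasTemperateGrowth_pd hf j) j) g
  · exact fun j _ ↦ integrable_smul_schwartz hf (schwartzPd j (schwartzPd j g))

lemma pd_comp_smul (f : EuclideanSpace ℝ (Fin n) → F) (c : ℝ) (j : Fin n) :
    pd j (fun x ↦ f (c • x)) = fun x ↦ c • pd j f (c • x) := by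
  ext x
  simp [pd, fderiv_comp_smul]

lemma pd_const_smul (f : EuclideanSpace ℝ (Fin n) → F) (c : ℝ) (j : Fin n) :
    pd j (fun x ↦ c • f x) = fun x ↦ c • pd j f x := by
  ext x
  have := congrFun (fderiv_const_smul_field (𝕜 := ℝ) (f := f) c) x
  simp only [pd]
  exact congrArg (· (EuclideanSpace.single j 1)) this

lemma lap_comp_smul (f : EuclideanSpace ℝ (Fin n) → F) (c : ℝ) :
    lap (fun x ↦ f (c • x)) = fun x ↦ c ^ 2 • lap f (c • x) := by
  ext x
  simp only [lap, pd_comp_smul, pd_const_smul, smul_smul, Finset.smul_sum, sq]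

lemma lap_const_smul (f : EuclideanSpace ℝ (Fin n) → F) (c : ℝ) :
    lap (fun x ↦ c • f x) = fun x ↦ c • lap f x := by
  ext x
  simp only [lap, pd_const_smul, Finset.smul_sum]

lemma lap_add {f g : EuclideanSpace ℝ (Fin n) → F} (hf : f.HasTemperateGrowth)
    (hg : g.HasTemperateGrowth) : lap (fun x ↦ f x + g x) = fun x ↦ lap f x + lap g x := by
  have key : ∀ {f g : EuclideanSpace ℝ (Fin n) → F}, f.HasTemperateGrowth →
      g.HasTemperateGrowth → ∀ j, pd j (fun x ↦ f x + g x) = fun x ↦ pd j f x + pd j g x := by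
    intro f g hf hg j
    ext x
    simp only [pd]
    rw [fderiv_fun_add (hf.1.contDiffAt.differentiableAt (by simp))
      (hg.1.contDiffAt.differentiableAt (by simp))]
    rfl
  ext x
  simp only [lap, ← Finset.sum_add_distrib]
  refine Finset.sum_congr rfl fun j _ ↦ ?_
  rw [key hf hg, key (hasTemperateGrowth_pd hf j) (hasTemperateGrowth_pd hg j)]

end PartialDerivatives

section Bracket

variable {n : ℕ}

lemma hasFDerivAt_one_add_norm_sq_rpow (s : ℝ) (x : EuclideanSpace ℝ (Fin n)) :
    HasFDerivAt (fun x : EuclideanSpace ℝ (Fin n) ↦ (1 + ‖x‖ ^ 2) ^ s)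
      ((s * (1 + ‖x‖ ^ 2) ^ (s - 1)) • (2 • innerSL ℝ x)) x :=
  ((hasStrictFDerivAt_norm_sq x).hasFDerivAt.const_add 1).rpow_const (.inl (by positivity))

lemma pd_one_add_norm_sq_rpow (s : ℝ) (j : Fin n) :
    pd j (fun x : EuclideanSpace ℝ (Fin n) ↦ (1 + ‖x‖ ^ 2) ^ s) =
      fun x ↦ (2 * s) * ((1 + ‖x‖ ^ 2) ^ (s - 1) * x j) := by
  ext x
  rw [pd, (hasFDerivAt_one_add_norm_sq_rpow s x).fderiv]
  simp [EuclideanSpace.inner_single_right]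
  ring

lemma pd_pd_one_add_norm_sq_rpow (s : ℝ) (j : Fin n) (x : EuclideanSpace ℝ (Fin n)) :
    pd j (pd j fun x : EuclideanSpace ℝ (Fin n) ↦ (1 + ‖x‖ ^ 2) ^ s) x =
      2 * s * (1 + ‖x‖ ^ 2) ^ (s - 1) +
        4 * s * (s - 1) * (1 + ‖x‖ ^ 2) ^ (s - 1 - 1) * x j ^ 2 := by
  rw [pd_one_add_norm_sq_rpow, pd]
  have h := ((hasFDerivAt_one_add_norm_sq_rpow (s - 1) x).fun_mul
    (EuclideanSpace.proj (𝕜 := ℝ) j).hasFDerivAt).const_mul (2 * s)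
  simp only [PiLp.proj_apply] at h
  rw [h.fderiv]
  simp [EuclideanSpace.inner_single_right]
  ring

lemma lap_one_add_norm_sq_rpow (s : ℝ) :
    lap (fun x : EuclideanSpace ℝ (Fin n) ↦ (1 + ‖x‖ ^ 2) ^ s) = fun x ↦
      (2 * s * (n + 2 * s - 2)) • (1 + ‖x‖ ^ 2) ^ (s - 1) +
        (-4 * s * (s - 1)) • (1 + ‖x‖ ^ 2) ^ (s - 2) := by
  ext x
  have h : (1 + ‖x‖ ^ 2) ^ (s - 1) = (1 + ‖x‖ ^ 2) ^ (s - 2) * (1 + ‖x‖ ^ 2) := by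
    rw [← Real.rpow_add_one (by positivity)]
    congr 1
    ring
  simp only [lap, pd_pd_one_add_norm_sq_rpow, Finset.sum_add_distrib, ← Finset.mul_sum,
    ← EuclideanSpace.real_norm_sq_eq, Finset.sum_const, Finset.card_univ, Fintype.card_fin,
    nsmul_eq_mul, smul_eq_mul, sub_sub, one_add_one_eq_two]
  rw [h]
  ring

lemma lap_lap_one_add_norm_sq_rpow_half :
    lap (lap fun x : EuclideanSpace ℝ (Fin 3) ↦ (1 + ‖x‖ ^ 2) ^ (1 / 2 : ℝ)) =
      fun x ↦ -15 * (1 + ‖x‖ ^ 2) ^ (-7 / 2 : ℝ) := by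
  have ht := Function.hasTemperateGrowth_one_add_norm_sq_rpow (EuclideanSpace ℝ (Fin 3))
  have hc (c s : ℝ) : (fun x : EuclideanSpace ℝ (Fin 3) ↦
      c • (1 + ‖x‖ ^ 2) ^ s).HasTemperateGrowth := .smul (.const c) (ht s)
  rw [lap_one_add_norm_sq_rpow, lap_add (hc _ _) (hc _ _), lap_const_smul, lap_const_smul,
    lap_one_add_norm_sq_rpow, lap_one_add_norm_sq_rpow]
  ext x
  norm_num
  ring

end Bracket

section Mass

lemma hasDerivAt_sin_arctan_pow (r : ℝ) :
    HasDerivAt (fun r ↦ Real.sin (Real.arctan r) ^ 3 / 3 - Real.sin (Real.arctan r) ^ 5 / 5)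
      (r ^ 2 * (1 + r ^ 2) ^ (-7 / 2 : ℝ)) r := by
  have h := (Real.hasDerivAt_arctan r).sin
  convert! ((h.pow 3).div_const 3).sub ((h.pow 5).div_const 5) using 1
  have hp : 0 < 1 + r ^ 2 := by positivity
  have hw : (1 + r ^ 2) ^ (-7 / 2 : ℝ) = (√(1 + r ^ 2))⁻¹ ^ 7 := by
    rw [Real.sqrt_eq_rpow, ← Real.rpow_neg hp.le, ← Real.rpow_mul_natCast hp.le]
    norm_num
  have hs : 0 < √(1 + r ^ 2) := Real.sqrt_pos.2 hp
  have hq : √(1 + r ^ 2) ^ 2 = 1 + r ^ 2 := Real.sq_sqrt hp.le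
  rw [hw, Real.sin_arctan, Real.cos_arctan]
  generalize √(1 + r ^ 2) = q at hs hq ⊢
  rw [← hq]
  simp only [Nat.reduceSub, Nat.cast_ofNat]
  field_simp
  linear_combination -r ^ 2 * hq

lemma tendsto_sin_arctan_pow :
    Filter.Tendsto
      (fun r ↦ Real.sin (Real.arctan r) ^ 3 / 3 - Real.sin (Real.arctan r) ^ 5 / 5)
      Filter.atTop (nhds (2 / 15)) := by
  have h : Filter.Tendsto (fun r ↦ Real.sin (Real.arctan r)) Filter.atTop (nhds 1) := by
    simpa [Function.comp_def] using (Real.continuous_sin.tendsto (π / 2)).comp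
      (Real.tendsto_arctan_atTop.mono_right nhdsWithin_le_nhds)
  convert! ((h.pow 3).div_const 3).sub ((h.pow 5).div_const 5) using 2
  norm_num

lemma integral_one_add_norm_sq_rpow_neg :
    ∫ x : EuclideanSpace ℝ (Fin 3), (1 + ‖x‖ ^ 2) ^ (-7 / 2 : ℝ) = 8 * π / 15 := by
  rw [integral_fun_norm_addHaar volume fun r : ℝ ↦ (1 + r ^ 2) ^ (-7 / 2 : ℝ)]
  have h : ∫ r in Set.Ioi (0 : ℝ), r ^ 2 * (1 + r ^ 2) ^ (-7 / 2 : ℝ) = 2 / 15 := by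
    rw [integral_Ioi_of_hasDerivAt_of_nonneg' (fun r _ ↦ hasDerivAt_sin_arctan_pow r)
      (fun r _ ↦ by positivity) tendsto_sin_arctan_pow]
    simp
  have hv : volume.real (Metric.ball (0 : EuclideanSpace ℝ (Fin 3)) 1) = π * 4 / 3 := by
    rw [measureReal_def, EuclideanSpace.volume_ball_fin_three]
    simp
    positivity
  simp only [finrank_euclideanSpace, Fintype.card_fin, hv, smul_eq_mul, nsmul_eq_mul,
    Nat.add_one_sub_one]
  rw [h]
  push_cast
  ring

lemma integrable_one_add_norm_sq_rpow_neg :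
    Integrable fun x : EuclideanSpace ℝ (Fin 3) ↦ (1 + ‖x‖ ^ 2) ^ (-7 / 2 : ℝ) :=
  integrable_rpow_neg_one_add_norm_sq (by norm_num)

end Mass

/-- The bi-Laplacian of the regularized norm `√(c ^ 2 + |x| ^ 2)`, tested against a Schwartz
function. -/
lemma integral_sqrt_smul_lap_lap (φ : SchwartzMap (EuclideanSpace ℝ (Fin 3)) ℂ) {c : ℝ}
    (hc : 0 < c) :
    ∫ x, √(c ^ 2 + ‖x‖ ^ 2) • lap (lap φ) x =
      ∫ x, (-15 * (1 + ‖x‖ ^ 2) ^ (-7 / 2 : ℝ)) • φ (c • x) := by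
  set a : EuclideanSpace ℝ (Fin 3) → ℝ := fun x ↦ (1 + ‖x‖ ^ 2) ^ (1 / 2 : ℝ) with ha
  have ht : a.HasTemperateGrowth := Function.hasTemperateGrowth_one_add_norm_sq_rpow _ _
  set ψ : SchwartzMap (EuclideanSpace ℝ (Fin 3)) ℂ :=
    SchwartzMap.compCLMOfContinuousLinearEquiv ℝ
      (ContinuousLinearEquiv.smulLeft (Units.mk0 c hc.ne')) φ
  have hψ : ⇑ψ = fun x ↦ φ (c • x) := rfl
  have h₁ := integral_smul_lap ht (schwartzLap ψ)
  rw [coe_schwartzLap, integral_smul_lap (hasTemperateGrowth_lap ht) ψ, ha,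
    lap_lap_one_add_norm_sq_rpow_half, hψ, lap_comp_smul, lap_const_smul, lap_comp_smul] at h₁
  rw [← h₁]
  have hs (x : EuclideanSpace ℝ (Fin 3)) :
      √(c ^ 2 + ‖c • x‖ ^ 2) = c * (1 + ‖x‖ ^ 2) ^ (1 / 2 : ℝ) := by
    rw [norm_smul, Real.norm_of_nonneg hc.le, ← Real.sqrt_eq_rpow, mul_pow,
      show c ^ 2 + c ^ 2 * ‖x‖ ^ 2 = c ^ 2 * (1 + ‖x‖ ^ 2) by ring,
      Real.sqrt_mul (by positivity), Real.sqrt_sq hc.le]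
  have h₂ := Measure.integral_comp_smul_of_nonneg volume
    (fun x : EuclideanSpace ℝ (Fin 3) ↦ √(c ^ 2 + ‖x‖ ^ 2) • lap (lap φ) x) c (hR := hc.le)
  rw [finrank_euclideanSpace, Fintype.card_fin, eq_inv_smul_iff₀ (by positivity),
    ← integral_smul] at h₂
  rw [← h₂]
  refine integral_congr_ae (.of_forall fun x ↦ ?_)
  simp only [hs, smul_smul]
  congr 1
  ring

lemma tendsto_integral_sqrt_smul {n : ℕ} {F : Type*} [NormedAddCommGroup F] [NormedSpace ℝ F]
    (g : SchwartzMap (EuclideanSpace ℝ (Fin n)) F) :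
    Filter.Tendsto (fun c : ℝ ↦ ∫ x, √(c ^ 2 + ‖x‖ ^ 2) • g x) (nhdsWithin 0 (Set.Ioi 0))
      (nhds (∫ x, ‖x‖ • g x)) := by
  refine tendsto_integral_filter_of_dominated_convergence (fun x ↦ ‖g x‖ + ‖x‖ * ‖g x‖)
    (.of_forall fun c ↦ ?_) ?_ ?_ (.of_forall fun x ↦ ?_)
  · exact (Continuous.smul (by fun_prop) g.continuous).aestronglyMeasurable
  · filter_upwards [Ioo_mem_nhdsGT (zero_lt_one' ℝ)] with c hc
    refine .of_forall fun x ↦ ?_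
    rw [norm_smul, Real.norm_of_nonneg (Real.sqrt_nonneg _), ← one_add_mul]
    gcongr
    refine Real.sqrt_le_iff.2 ⟨by positivity, ?_⟩
    nlinarith [norm_nonneg x, hc.1, hc.2]
  · exact g.integrable.norm.add (by simpa using g.integrable_pow_mul volume 1)
  · have : Continuous fun c : ℝ ↦ √(c ^ 2 + ‖x‖ ^ 2) • g x := by fun_prop
    simpa using (this.tendsto 0).mono_left nhdsWithin_le_nhds

lemma tendsto_integral_smul_comp_smul {n : ℕ} {F : Type*} [NormedAddCommGroup F]
    [NormedSpace ℝ F] (g : SchwartzMap (EuclideanSpace ℝ (Fin n)) F)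
    {k : EuclideanSpace ℝ (Fin n) → ℝ} (hk : Integrable k) :
    Filter.Tendsto (fun c : ℝ ↦ ∫ x, k x • g (c • x)) (nhdsWithin 0 (Set.Ioi 0))
      (nhds (∫ x, k x • g 0)) := by
  refine tendsto_integral_filter_of_dominated_convergence
    (fun x ↦ ‖k x‖ * SchwartzMap.seminorm ℝ 0 0 g) (.of_forall fun c ↦ ?_)
    (.of_forall fun c ↦ .of_forall fun x ↦ ?_) (hk.norm.mul_const _) (.of_forall fun x ↦ ?_)
  · have : Continuous fun x ↦ g (c • x) := g.continuous.comp (by fun_prop)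
    exact hk.aestronglyMeasurable.smul this.aestronglyMeasurable
  · rw [norm_smul]
    gcongr
    exact SchwartzMap.norm_le_seminorm ℝ g _
  · have : Continuous fun c : ℝ ↦ k x • g (c • x) :=
      (g.continuous.comp (by fun_prop)).const_smul _
    simpa using (this.tendsto 0).mono_left nhdsWithin_le_nhds

/-- The distributional bi-Laplacian of `|x|` on `ℝ³` is `-8π δ₀`:
`∫ |x| ΔΔφ = -8π φ(0)` for every Schwartz `φ`. -/
theorem biLaplacian_norm_three_dim (φ : SchwartzMap (EuclideanSpace ℝ (Fin 3)) ℂ) :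
    ∫ x, (‖x‖ : ℂ) * lap (lap ⇑φ) x = -((8 * Real.pi : ℝ) : ℂ) * φ 0 := by
  have hL := tendsto_integral_sqrt_smul (schwartzLap (schwartzLap φ))
  have hR := tendsto_integral_smul_comp_smul φ (integrable_one_add_norm_sq_rpow_neg.const_mul (-15))
  simp only [coe_schwartzLap] at hL
  have h := tendsto_nhds_unique (hL.congr' ?_) hR
  · rw [integral_smul_const, integral_const_mul, integral_one_add_norm_sq_rpow_neg] at h
    simp only [Complex.real_smul] at h
    rw [h]
    push_cast
    ring
  · filter_upwards [self_mem_nhdsWithin] with c hc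
    exact integral_sqrt_smul_lap_lap φ hc

end
end

section
/- There is an absolute constant C such that for every T > 0 and every solution u of the defocusing cubic NLS on [0,T] × ℝ (one space dimension), ∫₀^T ∫_{ℝ} |u(t,x)|⁶ dx dt ≤ C · T^{1/3} · ( sup_{t ∈ [0,T]} ‖u(t,·)‖_{L²(ℝ)}⁵ ‖u(t,·)‖_{Ḣ¹(ℝ)} + sup_{t ∈ [0,T]} ‖u(t,·)‖_{L²(ℝ)}⁶ ). -/
open MeasureTheory Real Complex
open scoped FourierTransform ENNReal ContDiff

noncomputable section

/-- The derivative in the second (space) variable. -/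
def pdx (f : ℝ → ℝ → ℝ) (t x : ℝ) : ℝ := deriv (f t) x

/-- The derivative in the first (time) variable. -/
def pdt (f : ℝ → ℝ → ℝ) (t x : ℝ) : ℝ := deriv (fun s => f s x) t

/-- Joint smoothness of a function of two real variables. -/
def Smooth₂ (f : ℝ → ℝ → ℝ) : Prop := ContDiff ℝ ∞ (Function.uncurry f)

namespace Smooth₂

variable {f g : ℝ → ℝ → ℝ}

lemma hasDerivAt_slice_x (hf : Smooth₂ f) (t x : ℝ) :
    HasDerivAt (f t) (fderiv ℝ (Function.uncurry f) (t, x) (0, 1)) x := by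
  have h1 : HasFDerivAt (Function.uncurry f) (fderiv ℝ (Function.uncurry f) (t, x)) (t, x) :=
    (hf.differentiable (by simp) _).hasFDerivAt
  have h2 : HasDerivAt (fun y : ℝ => (t, y)) ((0 : ℝ), (1 : ℝ)) x :=
    (hasDerivAt_const x t).prodMk (hasDerivAt_id x)
  exact h1.comp_hasDerivAt x h2

lemma hasDerivAt_slice_t (hf : Smooth₂ f) (t x : ℝ) :
    HasDerivAt (fun s => f s x) (fderiv ℝ (Function.uncurry f) (t, x) (1, 0)) t := by
  have h1 : HasFDerivAt (Function.uncurry f) (fderiv ℝ (Function.uncurry f) (t, x)) (t, x) :=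
    (hf.differentiable (by simp) _).hasFDerivAt
  have h2 : HasDerivAt (fun y : ℝ => (y, x)) ((1 : ℝ), (0 : ℝ)) t :=
    (hasDerivAt_id t).prodMk (hasDerivAt_const t x)
  exact h1.comp_hasDerivAt t h2

lemma pdx_eq (hf : Smooth₂ f) (t x : ℝ) :
    pdx f t x = fderiv ℝ (Function.uncurry f) (t, x) (0, 1) :=
  (hf.hasDerivAt_slice_x t x).deriv

lemma pdt_eq (hf : Smooth₂ f) (t x : ℝ) :
    pdt f t x = fderiv ℝ (Function.uncurry f) (t, x) (1, 0) :=
  (hf.hasDerivAt_slice_t t x).deriv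

lemma hasDerivAt_x (hf : Smooth₂ f) (t x : ℝ) : HasDerivAt (f t) (pdx f t x) x := by
  rw [hf.pdx_eq]; exact hf.hasDerivAt_slice_x t x

lemma hasDerivAt_t (hf : Smooth₂ f) (t x : ℝ) :
    HasDerivAt (fun s => f s x) (pdt f t x) t := by
  rw [hf.pdt_eq]; exact hf.hasDerivAt_slice_t t x

lemma pdx (hf : Smooth₂ f) : Smooth₂ (pdx f) := by
  have h : Function.uncurry (_root_.pdx f)
      = fun p => fderiv ℝ (Function.uncurry f) p (0, 1) := by
    ext ⟨t, x⟩; exact hf.pdx_eq t x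
  unfold Smooth₂
  rw [h]
  exact (hf.fderiv_right (m := ∞) (by simp)).clm_apply contDiff_const

lemma pdt (hf : Smooth₂ f) : Smooth₂ (pdt f) := by
  have h : Function.uncurry (_root_.pdt f)
      = fun p => fderiv ℝ (Function.uncurry f) p (1, 0) := by
    ext ⟨t, x⟩; exact hf.pdt_eq t x
  unfold Smooth₂
  rw [h]
  exact (hf.fderiv_right (m := ∞) (by simp)).clm_apply contDiff_const

lemma pdt_pdx (hf : Smooth₂ f) (t x : ℝ) :
    _root_.pdt (_root_.pdx f) t x = _root_.pdx (_root_.pdt f) t x := by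
  have hd : DifferentiableAt ℝ (fderiv ℝ (Function.uncurry f)) (t, x) :=
    (hf.fderiv_right (m := ∞) (by simp)).differentiable (by simp) _
  have hsymm : IsSymmSndFDerivAt ℝ (Function.uncurry f) (t, x) :=
    (ContDiff.contDiffAt hf).isSymmSndFDerivAt (by
      simpa using WithTop.coe_le_coe.2 (le_top : (2 : ℕ∞) ≤ ⊤))
  rw [hf.pdx.pdt_eq, hf.pdt.pdx_eq]
  have h : Function.uncurry (_root_.pdx f)
      = fun p => fderiv ℝ (Function.uncurry f) p (0, 1) := by
    ext ⟨t, x⟩; exact hf.pdx_eq t x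
  have h' : Function.uncurry (_root_.pdt f)
      = fun p => fderiv ℝ (Function.uncurry f) p (1, 0) := by
    ext ⟨t, x⟩; exact hf.pdt_eq t x
  rw [h, h', fderiv_clm_apply hd (differentiableAt_const _),
    fderiv_clm_apply hd (differentiableAt_const _)]
  simpa using hsymm (1, 0) (0, 1)

lemma continuous (hf : Smooth₂ f) : Continuous (Function.uncurry f) := ContDiff.continuous hf

lemma continuous_x (hf : Smooth₂ f) (t : ℝ) : Continuous (f t) :=
  hf.continuous.comp (Continuous.prodMk_right t)

lemma add (hf : Smooth₂ f) (hg : Smooth₂ g) : Smooth₂ (fun t x => f t x + g t x) :=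
  ContDiff.add hf hg

lemma sub (hf : Smooth₂ f) (hg : Smooth₂ g) : Smooth₂ (fun t x => f t x - g t x) :=
  ContDiff.sub hf hg

lemma mul (hf : Smooth₂ f) (hg : Smooth₂ g) : Smooth₂ (fun t x => f t x * g t x) :=
  ContDiff.mul hf hg

lemma pow (hf : Smooth₂ f) (n : ℕ) : Smooth₂ (fun t x => f t x ^ n) :=
  ContDiff.pow hf n

lemma freeze (hf : Smooth₂ f) (s : ℝ) : Smooth₂ (fun _ x => f s x) := by
  have : ContDiff ℝ ∞ (fun p : ℝ × ℝ => (s, p.2)) := contDiff_const.prodMk contDiff_snd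
  exact ContDiff.comp (g := Function.uncurry f) hf this

lemma shift (hf : Smooth₂ f) (τ : ℝ) : Smooth₂ (fun t x => f (t + τ) x) := by
  have : ContDiff ℝ ∞ (fun p : ℝ × ℝ => (p.1 + τ, p.2)) :=
    (contDiff_fst.add contDiff_const).prodMk contDiff_snd
  exact ContDiff.comp (g := Function.uncurry f) hf this

end Smooth₂

lemma smooth₂_const (c : ℝ) : Smooth₂ (fun _ _ => c) := contDiff_const

/-- Differentiation under the integral sign on a compact interval. -/
lemma hasDerivAt_intervalIntegral_of_continuous {G G' : ℝ → ℝ → ℝ} {A B : ℝ}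
    (hG : Continuous (Function.uncurry G)) (hG' : Continuous (Function.uncurry G'))
    (h : ∀ t x, HasDerivAt (fun s => G s x) (G' t x) t) (t : ℝ) :
    HasDerivAt (fun s => ∫ x in A..B, G s x) (∫ x in A..B, G' t x) t := by
  obtain ⟨C, hC⟩ := ((isCompact_Icc (a := t - 1) (b := t + 1)).prod
    (isCompact_uIcc (a := A) (b := B))).exists_bound_of_continuousOn hG'.continuousOn
  have hx : ∀ s, Continuous (G s) := fun s => hG.comp (Continuous.prodMk_right s)
  have hx' : ∀ s, Continuous (G' s) := fun s => hG'.comp (Continuous.prodMk_right s)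
  refine (intervalIntegral.hasDerivAt_integral_of_dominated_loc_of_deriv_le
    (F := G) (F' := G') (bound := fun _ => C) (Icc_mem_nhds (a := t - 1) (b := t + 1)
      (by linarith) (by linarith)) ?_ ?_ ?_ ?_ ?_ ?_).2
  · exact Filter.Eventually.of_forall fun s => (hx s).aestronglyMeasurable
  · exact (hx t).intervalIntegrable _ _
  · exact (hx' t).aestronglyMeasurable
  · refine Filter.Eventually.of_forall fun x hxm s hs => ?_
    exact hC (s, x) ⟨hs, Set.uIoc_subset_uIcc hxm⟩
  · exact intervalIntegrable_const
  · exact Filter.Eventually.of_forall fun x _ s _ => h s x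

/-- A polynomial cutoff on `[-R, R]`, vanishing to second order at the endpoints. -/
def cutoff (R x : ℝ) : ℝ := (1 - (x / R) ^ 2) ^ 2

/-- The derivative of `cutoff`. -/
def cutoffDeriv (R x : ℝ) : ℝ := -4 * x / R ^ 2 * (1 - (x / R) ^ 2)

/-- The second derivative of `cutoff`. -/
def cutoffDeriv₂ (R x : ℝ) : ℝ := -4 / R ^ 2 + 12 * x ^ 2 / R ^ 4

section cutoff

variable {R x : ℝ}

lemma hasDerivAt_cutoff (hR : 0 < R) (x : ℝ) :
    HasDerivAt (cutoff R) (cutoffDeriv R x) x := by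
  have h := (((hasDerivAt_id x).div_const R).pow 2).const_sub 1 |>.pow 2
  refine HasDerivAt.congr_deriv (f := cutoff R) h ?_
  have hR' := hR.ne'
  simp [cutoffDeriv]
  field_simp
  ring

lemma hasDerivAt_cutoffDeriv (hR : 0 < R) (x : ℝ) :
    HasDerivAt (cutoffDeriv R) (cutoffDeriv₂ R x) x := by
  have h := (((hasDerivAt_id x).const_mul (-4)).div_const (R ^ 2)).mul
    ((((hasDerivAt_id x).div_const R).pow 2).const_sub 1)
  refine HasDerivAt.congr_deriv (f := cutoffDeriv R) h ?_
  have hR' := hR.ne'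
  simp [cutoffDeriv₂]
  field_simp
  ring

lemma continuous_cutoff (R : ℝ) : Continuous (cutoff R) := by
  unfold cutoff; fun_prop

lemma continuous_cutoffDeriv (R : ℝ) : Continuous (cutoffDeriv R) := by
  unfold cutoffDeriv; fun_prop

lemma continuous_cutoffDeriv₂ (R : ℝ) : Continuous (cutoffDeriv₂ R) := by
  unfold cutoffDeriv₂; fun_prop

lemma smooth₂_cutoff (R : ℝ) : Smooth₂ (fun _ x => cutoff R x) := by
  unfold Smooth₂ cutoff Function.uncurry; fun_prop

lemma cutoff_nonneg (R x : ℝ) : 0 ≤ cutoff R x := sq_nonneg _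

lemma cutoff_right (hR : 0 < R) : cutoff R R = 0 := by simp [cutoff, hR.ne']

lemma cutoff_left (hR : 0 < R) : cutoff R (-R) = 0 := by simp [cutoff, hR.ne']

lemma cutoffDeriv_right (hR : 0 < R) : cutoffDeriv R R = 0 := by simp [cutoffDeriv, hR.ne']

lemma cutoffDeriv_left (hR : 0 < R) : cutoffDeriv R (-R) = 0 := by
  simp [cutoffDeriv, hR.ne']

lemma div_sq_le_one (hR : 0 < R) (hx : x ∈ Set.Icc (-R) R) : (x / R) ^ 2 ≤ 1 := by
  rw [sq_le_one_iff_abs_le_one, abs_div, abs_of_pos hR, div_le_one hR]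
  exact abs_le.2 hx

lemma cutoff_le_one (hR : 0 < R) (hx : x ∈ Set.Icc (-R) R) : cutoff R x ≤ 1 := by
  have := div_sq_le_one hR hx
  unfold cutoff
  nlinarith [sq_nonneg (x / R)]

lemma abs_cutoffDeriv_le (hR : 0 < R) (hx : x ∈ Set.Icc (-R) R) :
    |cutoffDeriv R x| ≤ 4 / R := by
  have h1 := div_sq_le_one hR hx
  have h2 : cutoffDeriv R x = -(4 / R) * ((x / R) * (1 - (x / R) ^ 2)) := by
    unfold cutoffDeriv; field_simp
  have h3 : |x / R| ≤ 1 := by rwa [← sq_le_one_iff_abs_le_one]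
  rw [h2, abs_mul, abs_neg, abs_of_pos (by positivity : 0 < 4 / R)]
  refine mul_le_of_le_one_right (by positivity) ?_
  rw [abs_mul]
  refine mul_le_one₀ h3 (abs_nonneg _) ?_
  rw [abs_le]
  constructor <;> nlinarith [sq_nonneg (x / R)]

lemma abs_cutoffDeriv₂_le (hR : 1 ≤ R) (hx : x ∈ Set.Icc (-R) R) :
    |cutoffDeriv₂ R x| ≤ 8 / R := by
  have hR0 : 0 < R := by linarith
  have h1 := div_sq_le_one hR0 hx
  have h2 : cutoffDeriv₂ R x = 1 / R ^ 2 * (12 * (x / R) ^ 2 - 4) := by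
    unfold cutoffDeriv₂; field_simp; ring
  have h3 : 1 / R ^ 2 ≤ 1 / R := by
    apply one_div_le_one_div_of_le hR0; nlinarith
  have h4 : |12 * (x / R) ^ 2 - 4| ≤ 8 := by
    rw [abs_le]; constructor <;> nlinarith [sq_nonneg (x / R)]
  rw [h2, abs_mul, abs_of_pos (by positivity : 0 < 1 / R ^ 2)]
  calc 1 / R ^ 2 * |12 * (x / R) ^ 2 - 4| ≤ 1 / R * 8 := by gcongr
    _ = 8 / R := by ring

lemma integral_add_of_continuous {f g : ℝ → ℝ} (hf : Continuous f) (hg : Continuous g)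
    {A B : ℝ} : ∫ x in A..B, (f x + g x) = (∫ x in A..B, f x) + ∫ x in A..B, g x :=
  intervalIntegral.integral_add (hf.intervalIntegrable _ _) (hg.intervalIntegrable _ _)

/-- Integration by parts against a weight that vanishes at both endpoints. -/
lemma integral_mul_deriv_of_vanish {A B : ℝ} {χ χ' F F' : ℝ → ℝ}
    (hχ : ∀ x, HasDerivAt χ (χ' x) x) (hχ' : Continuous χ') (hA : χ A = 0) (hB : χ B = 0)
    (hF : ∀ x, HasDerivAt F (F' x) x) (hF' : Continuous F') :
    ∫ x in A..B, χ x * F' x = -∫ x in A..B, χ' x * F x := by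
  rw [intervalIntegral.integral_mul_deriv_eq_deriv_mul (fun x _ => hχ x) (fun x _ => hF x)
    (hχ'.intervalIntegrable _ _) (hF'.intervalIntegrable _ _), hA, hB]
  simp

lemma abs_integral_cutoffDeriv_mul_le {F : ℝ → ℝ} {K : ℝ} (hR : 0 < R) (hF : Continuous F)
    (hK : ∫ x in (-R)..R, |F x| ≤ K) :
    |∫ x in (-R)..R, cutoffDeriv R x * F x| ≤ 4 / R * K := by
  have hle : -R ≤ R := by linarith
  calc |∫ x in (-R)..R, cutoffDeriv R x * F x|
      ≤ ∫ x in (-R)..R, |cutoffDeriv R x * F x| :=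
        intervalIntegral.abs_integral_le_integral_abs hle
    _ ≤ ∫ x in (-R)..R, 4 / R * |F x| := by
        refine intervalIntegral.integral_mono_on hle
          (((continuous_cutoffDeriv R).mul hF).abs.intervalIntegrable _ _)
          ((continuous_const.mul hF.abs).intervalIntegrable _ _) fun x hx => ?_
        rw [abs_mul]
        exact mul_le_mul_of_nonneg_right (abs_cutoffDeriv_le hR hx) (abs_nonneg _)
    _ ≤ 4 / R * K := by
        rw [intervalIntegral.integral_const_mul]; gcongr

/-- If the cutoff integrals of `g ≥ 0` are bounded up to `O(1/R)`, so are its integrals over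
compact intervals. -/
lemma integral_le_of_cutoff_le {g : ℝ → ℝ} (hg : Continuous g) (hg0 : ∀ x, 0 ≤ g x) {m C : ℝ}
    (h : ∀ R ≥ 1, ∫ x in (-R)..R, cutoff R x * g x ≤ m + C / R) {r : ℝ} (hr : 0 < r) :
    ∫ x in (-r)..r, g x ≤ m := by
  have key : ∀ R ≥ max r 1, (1 - (r / R) ^ 2) ^ 2 * ∫ x in (-r)..r, g x ≤ m + C / R := by
    intro R hR
    have hrR : r ≤ R := (le_max_left _ _).trans hR
    have hR0 : 0 < R := hr.trans_le hrR
    refine le_trans ?_ (h R ((le_max_right _ _).trans hR))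
    have hc : Continuous fun x => cutoff R x * g x := (continuous_cutoff R).mul hg
    calc (1 - (r / R) ^ 2) ^ 2 * ∫ x in (-r)..r, g x
        = ∫ x in (-r)..r, (1 - (r / R) ^ 2) ^ 2 * g x := by
          rw [intervalIntegral.integral_const_mul]
      _ ≤ ∫ x in (-r)..r, cutoff R x * g x := by
          refine intervalIntegral.integral_mono_on (by linarith)
            ((continuous_const.mul hg).intervalIntegrable _ _)
            (hc.intervalIntegrable _ _) fun x hx => ?_
          refine mul_le_mul_of_nonneg_right ?_ (hg0 x)
          unfold cutoff
          have h1 : (x / R) ^ 2 ≤ (r / R) ^ 2 := by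
            rw [div_pow, div_pow]
            gcongr 1
            nlinarith [hx.1, hx.2]
          have h2 : (r / R) ^ 2 ≤ 1 := div_sq_le_one hR0 ⟨by linarith, hrR⟩
          gcongr
      _ ≤ ∫ x in (-R)..R, cutoff R x * g x := by
          refine intervalIntegral.integral_mono_interval (by linarith) (by linarith) hrR
            (Filter.Eventually.of_forall fun x => mul_nonneg (cutoff_nonneg _ _) (hg0 x))
            (hc.intervalIntegrable _ _)
  have l1 : Filter.Tendsto (fun R : ℝ => r / R) Filter.atTop (nhds 0) :=
    tendsto_const_nhds.div_atTop Filter.tendsto_id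
  have l2 : Filter.Tendsto (fun R : ℝ => C / R) Filter.atTop (nhds 0) :=
    tendsto_const_nhds.div_atTop Filter.tendsto_id
  have l3 : Filter.Tendsto (fun R : ℝ => (1 - (r / R) ^ 2) ^ 2 * ∫ x in (-r)..r, g x)
      Filter.atTop (nhds ((1 - 0 ^ 2) ^ 2 * ∫ x in (-r)..r, g x)) :=
    (((tendsto_const_nhds.sub (l1.pow 2)).pow 2).mul_const _)
  have l4 : Filter.Tendsto (fun R : ℝ => m + C / R) Filter.atTop (nhds (m + 0)) :=
    tendsto_const_nhds.add l2
  have := le_of_tendsto_of_tendsto l3 l4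
    ((Filter.eventually_ge_atTop (max r 1)).mono key)
  simpa using this

lemma hasDerivAt_cutoff_integral {G : ℝ → ℝ → ℝ} (hG : Smooth₂ G) (R t : ℝ) :
    HasDerivAt (fun s => ∫ x in (-R)..R, cutoff R x * G s x)
      (∫ x in (-R)..R, cutoff R x * pdt G t x) t := by
  refine hasDerivAt_intervalIntegral_of_continuous
    (G := fun s x => cutoff R x * G s x) (G' := fun s x => cutoff R x * pdt G s x)
    ((smooth₂_cutoff R).mul hG).continuous ((smooth₂_cutoff R).mul hG.pdt).continuous
    (fun t x => (hG.hasDerivAt_t t x).const_mul _) t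

end cutoff

/-- Two-sided Grönwall inequality. -/
lemma two_sided_gronwall {y y' : ℝ → ℝ} {c d lam B : ℝ} (hlam : 0 ≤ lam) (hB : 0 ≤ B)
    (hy : ∀ t, HasDerivAt y (y' t) t) (h : ∀ t ∈ Set.Icc c d, |y' t| ≤ lam * y t + B)
    {s t : ℝ} (hs : s ∈ Set.Icc c d) (ht : t ∈ Set.Icc c d) :
    y t ≤ Real.exp (lam * |t - s|) * (y s + B * |t - s|) := by
  rcases le_total s t with hst | hst
  · have hz : ∀ r, HasDerivAt (fun r => Real.exp (-(lam * (r - s))) * y r - B * (r - s))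
        (Real.exp (-(lam * (r - s))) * (y' r - lam * y r) - B) r := by
      intro r
      have h1 : HasDerivAt (fun r => -(lam * (r - s))) (-(lam * 1)) r :=
        (((hasDerivAt_id r).sub_const s).const_mul lam).neg
      have h2 := (h1.exp.mul (hy r)).sub (((hasDerivAt_id r).sub_const s).const_mul B)
      refine h2.congr_deriv ?_
      ring
    have hanti : AntitoneOn (fun r => Real.exp (-(lam * (r - s))) * y r - B * (r - s))
        (Set.Icc s t) := by
      refine antitoneOn_of_deriv_nonpos (convex_Icc _ _)
        (fun r _ => (hz r).continuousAt.continuousWithinAt)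
        (fun r _ => (hz r).differentiableAt.differentiableWithinAt) fun r hr => ?_
      rw [interior_Icc] at hr
      rw [(hz r).deriv]
      have h1 := (abs_le.1 (h r ⟨hs.1.trans hr.1.le, hr.2.le.trans ht.2⟩)).2
      have h2 : Real.exp (-(lam * (r - s))) ≤ 1 := by
        rw [Real.exp_le_one_iff]
        have := mul_nonneg hlam (sub_nonneg.2 hr.1.le)
        linarith
      nlinarith [Real.exp_pos (-(lam * (r - s)))]
    have h3 := hanti (Set.left_mem_Icc.2 hst) (Set.right_mem_Icc.2 hst) hst
    simp only [sub_self, mul_zero, neg_zero, Real.exp_zero, one_mul, sub_zero] at h3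
    rw [abs_of_nonneg (sub_nonneg.2 hst)]
    rw [Real.exp_neg] at h3
    have h4 : (Real.exp (lam * (t - s)))⁻¹ * y t ≤ y s + B * (t - s) := by linarith
    rwa [inv_mul_le_iff₀ (Real.exp_pos _)] at h4
  · have hz : ∀ r, HasDerivAt (fun r => Real.exp (lam * (r - s)) * y r + B * (r - s))
        (Real.exp (lam * (r - s)) * (y' r + lam * y r) + B) r := by
      intro r
      have h1 : HasDerivAt (fun r => lam * (r - s)) (lam * 1) r :=
        ((hasDerivAt_id r).sub_const s).const_mul lam
      have h2 := (h1.exp.mul (hy r)).add (((hasDerivAt_id r).sub_const s).const_mul B)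
      refine h2.congr_deriv ?_
      ring
    have hmono : MonotoneOn (fun r => Real.exp (lam * (r - s)) * y r + B * (r - s))
        (Set.Icc t s) := by
      refine monotoneOn_of_deriv_nonneg (convex_Icc _ _)
        (fun r _ => (hz r).continuousAt.continuousWithinAt)
        (fun r _ => (hz r).differentiableAt.differentiableWithinAt) fun r hr => ?_
      rw [interior_Icc] at hr
      rw [(hz r).deriv]
      have h1 := (abs_le.1 (h r ⟨ht.1.trans hr.1.le, hr.2.le.trans hs.2⟩)).1
      have h2 : Real.exp (lam * (r - s)) ≤ 1 := by
        rw [Real.exp_le_one_iff]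
        have := mul_nonneg hlam (sub_nonneg.2 hr.2.le)
        linarith
      nlinarith [Real.exp_pos (lam * (r - s))]
    have h3 := hmono (Set.left_mem_Icc.2 hst) (Set.right_mem_Icc.2 hst) hst
    simp only [sub_self, mul_zero, Real.exp_zero, one_mul, add_zero] at h3
    rw [abs_of_nonpos (sub_nonpos.2 hst), neg_sub]
    have h5 : lam * (t - s) = -(lam * (s - t)) := by ring
    rw [h5, Real.exp_neg] at h3
    have h4 : (Real.exp (lam * (s - t)))⁻¹ * y t ≤ y s + B * (s - t) := by linarith
    rwa [inv_mul_le_iff₀ (Real.exp_pos _)] at h4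

/-- Grönwall's inequality for a density `G ≥ 0` that obeys a balance law `∂ₜG = -∂ₓF + S` with an
integrable flux `F` and a source `S` controlled by `G` up to an integrable error. -/
lemma balance_law_gronwall {G F h : ℝ → ℝ → ℝ} (hG : Smooth₂ G) (hF : Smooth₂ F)
    {c d lam K A m s t : ℝ} (hlam : 0 ≤ lam) (hA : 0 ≤ A) (hG0 : ∀ t x, 0 ≤ G t x)
    (hh : ∀ t, Continuous (h t)) (hh0 : ∀ t x, 0 ≤ h t x)
    (hS : ∀ t ∈ Set.Icc c d, ∀ x, |pdt G t x + pdx F t x| ≤ lam * G t x + h t x)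
    (hFK : ∀ t ∈ Set.Icc c d, ∀ R > 0, ∫ x in (-R)..R, |F t x| ≤ K)
    (hhA : ∀ t ∈ Set.Icc c d, ∀ R > 0, ∫ x in (-R)..R, h t x ≤ A)
    (hs : s ∈ Set.Icc c d) (ht : t ∈ Set.Icc c d)
    (hm : ∀ R > 0, ∫ x in (-R)..R, G s x ≤ m) {r : ℝ} (hr : 0 < r) :
    ∫ x in (-r)..r, G t x ≤ Real.exp (lam * |t - s|) * (m + A * |t - s|) := by
  have hK : 0 ≤ K := le_trans
    (intervalIntegral.integral_nonneg (by norm_num) fun x _ => abs_nonneg _) (hFK s hs 1 one_pos)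
  refine integral_le_of_cutoff_le (hG.continuous_x t) (hG0 t)
    (C := Real.exp (lam * |t - s|) * (4 * K * |t - s|)) (fun R hR => ?_) hr
  have hR0 : 0 < R := by linarith
  have hle : -R ≤ R := by linarith
  have hder : ∀ τ ∈ Set.Icc c d, |∫ x in (-R)..R, cutoff R x * pdt G τ x|
      ≤ lam * (∫ x in (-R)..R, cutoff R x * G τ x) + (4 / R * K + A) := by
    intro τ hτ
    have c0 := continuous_cutoff R
    have c1 := hG.pdt.continuous_x τ
    have c2 := hF.pdx.continuous_x τ
    have c3 := hG.continuous_x τ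
    have e1 : ∫ x in (-R)..R, cutoff R x * pdt G τ x
        = (∫ x in (-R)..R, cutoff R x * (pdt G τ x + pdx F τ x))
          + ∫ x in (-R)..R, cutoffDeriv R x * F τ x := by
      have := integral_mul_deriv_of_vanish (hasDerivAt_cutoff hR0) (continuous_cutoffDeriv R)
        (cutoff_left hR0) (cutoff_right hR0) (hF.hasDerivAt_x τ) c2
      rw [← sub_eq_iff_eq_add, sub_eq_add_neg, ← this,
        ← integral_add_of_continuous (f := fun x => cutoff R x * pdt G τ x) (by fun_prop)
          (by fun_prop)]
      simp only [mul_add]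
    have e2 : |∫ x in (-R)..R, cutoff R x * (pdt G τ x + pdx F τ x)|
        ≤ lam * (∫ x in (-R)..R, cutoff R x * G τ x) + A := by
      calc |∫ x in (-R)..R, cutoff R x * (pdt G τ x + pdx F τ x)|
          ≤ ∫ x in (-R)..R, |cutoff R x * (pdt G τ x + pdx F τ x)| :=
            intervalIntegral.abs_integral_le_integral_abs hle
        _ ≤ ∫ x in (-R)..R, (lam * (cutoff R x * G τ x) + h τ x) := by
            refine intervalIntegral.integral_mono_on hle
              ((c0.mul (c1.add c2)).abs.intervalIntegrable _ _)
              (((continuous_const.mul (c0.mul c3)).add (hh τ)).intervalIntegrable _ _)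
              fun x hx => ?_
            rw [abs_mul, abs_of_nonneg (cutoff_nonneg R x)]
            have k1 := mul_le_mul_of_nonneg_left (hS τ hτ x) (cutoff_nonneg R x)
            have k2 := mul_le_of_le_one_left (hh0 τ x) (cutoff_le_one hR0 hx)
            linarith
        _ ≤ _ := by
            rw [integral_add_of_continuous (f := fun x => lam * (cutoff R x * G τ x))
              (by fun_prop) (hh τ), intervalIntegral.integral_const_mul]
            gcongr
            exact hhA τ hτ R hR0
    have e3 := abs_integral_cutoffDeriv_mul_le hR0 (hF.continuous_x τ) (hFK τ hτ R hR0)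
    rw [e1]
    exact (abs_add_le _ _).trans (by linarith)
  have hg := two_sided_gronwall hlam (by positivity : 0 ≤ 4 / R * K + A)
    (hasDerivAt_cutoff_integral hG R) hder hs ht
  have hsm : ∫ x in (-R)..R, cutoff R x * G s x ≤ m := by
    refine le_trans (intervalIntegral.integral_mono_on hle
      (((continuous_cutoff R).mul (hG.continuous_x s)).intervalIntegrable _ _)
      ((hG.continuous_x s).intervalIntegrable _ _) fun x hx => ?_) (hm R hR0)
    exact mul_le_of_le_one_left (hG0 s x) (cutoff_le_one hR0 hx)
  refine hg.trans ?_
  calc _ ≤ Real.exp (lam * |t - s|) * (m + (4 / R * K + A) * |t - s|) := by gcongr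
    _ = _ := by field_simp; ring

section intervals

lemma intervalIntegral_le_of_le {f g : ℝ → ℝ} {K : ℝ} (hf : Continuous f)
    (hg : Integrable g) (hg0 : ∀ x, 0 ≤ g x) (hfg : ∀ x, f x ≤ g x) (hK : ∫ x, g x ≤ K)
    {R : ℝ} (hR : 0 < R) : ∫ x in (-R)..R, f x ≤ K := by
  have hle : -R ≤ R := by linarith
  calc ∫ x in (-R)..R, f x ≤ ∫ x in (-R)..R, g x :=
        intervalIntegral.integral_mono hle (hf.intervalIntegrable _ _)
          hg.intervalIntegrable hfg
    _ ≤ ∫ x, g x := by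
        rw [intervalIntegral.integral_of_le hle]
        exact setIntegral_le_integral hg (Filter.Eventually.of_forall hg0)
    _ ≤ K := hK

lemma integral_le_of_intervalIntegral_le {g : ℝ → ℝ} {m : ℝ} (hg : Integrable g)
    (h : ∀ r > 0, ∫ x in (-r)..r, g x ≤ m) : ∫ x, g x ≤ m :=
  le_of_tendsto (intervalIntegral_tendsto_integral hg Filter.tendsto_neg_atTop_atBot
    Filter.tendsto_id) ((Filter.eventually_gt_atTop 0).mono fun r hr => h r hr)

end intervals

/-- The real and imaginary parts of a smooth solution of the cubic NLS on `[0, T] × ℝ`, with the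
qualitative decay of each time slice that is needed below. -/
structure NLSPair (T : ℝ) (a b : ℝ → ℝ → ℝ) : Prop where
  smooth_a : Smooth₂ a
  smooth_b : Smooth₂ b
  eq_a : ∀ t ∈ Set.Icc 0 T, ∀ x,
    pdt a t x = -pdx (pdx b) t x + (a t x ^ 2 + b t x ^ 2) * b t x
  eq_b : ∀ t ∈ Set.Icc 0 T, ∀ x,
    pdt b t x = pdx (pdx a) t x - (a t x ^ 2 + b t x ^ 2) * a t x
  int_a : ∀ t ∈ Set.Icc 0 T, Integrable fun x => a t x ^ 2
  int_b : ∀ t ∈ Set.Icc 0 T, Integrable fun x => b t x ^ 2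
  int_ax : ∀ t ∈ Set.Icc 0 T, Integrable fun x => pdx a t x ^ 2
  int_bx : ∀ t ∈ Set.Icc 0 T, Integrable fun x => pdx b t x ^ 2
  int_axx : ∀ t ∈ Set.Icc 0 T, Integrable fun x => pdx (pdx a) t x ^ 2
  int_bxx : ∀ t ∈ Set.Icc 0 T, Integrable fun x => pdx (pdx b) t x ^ 2
  tendsto_a : ∀ t ∈ Set.Icc 0 T, Filter.Tendsto (a t) Filter.atBot (nhds 0)
  tendsto_b : ∀ t ∈ Set.Icc 0 T, Filter.Tendsto (b t) Filter.atBot (nhds 0)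

/-- The mass density. -/
def massDens (a b : ℝ → ℝ → ℝ) (t x : ℝ) : ℝ := a t x ^ 2 + b t x ^ 2

/-- The squared modulus of the gradient. -/
def gradDens (a b : ℝ → ℝ → ℝ) (t x : ℝ) : ℝ := pdx a t x ^ 2 + pdx b t x ^ 2

/-- The momentum density. -/
def momDens (a b : ℝ → ℝ → ℝ) (t x : ℝ) : ℝ := a t x * pdx b t x - b t x * pdx a t x

/-- The sum of the mass density and the energy density. -/
def energyDens (a b : ℝ → ℝ → ℝ) (t x : ℝ) : ℝ :=
  massDens a b t x + gradDens a b t x / 2 + massDens a b t x ^ 2 / 4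

lemma massDens_nonneg (a b : ℝ → ℝ → ℝ) (t x : ℝ) : 0 ≤ massDens a b t x := by
  unfold massDens; positivity

lemma gradDens_nonneg (a b : ℝ → ℝ → ℝ) (t x : ℝ) : 0 ≤ gradDens a b t x := by
  unfold gradDens; positivity

lemma energyDens_nonneg (a b : ℝ → ℝ → ℝ) (t x : ℝ) : 0 ≤ energyDens a b t x := by
  have := massDens_nonneg a b t x
  have := gradDens_nonneg a b t x
  unfold energyDens; positivity

lemma abs_momDens_le (a b : ℝ → ℝ → ℝ) (t x : ℝ) :
    |2 * momDens a b t x| ≤ massDens a b t x + gradDens a b t x := by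
  unfold momDens massDens gradDens
  rw [abs_le]
  constructor <;> nlinarith [sq_nonneg (a t x + pdx b t x), sq_nonneg (b t x - pdx a t x),
    sq_nonneg (a t x - pdx b t x), sq_nonneg (b t x + pdx a t x)]

section smooth

variable {a b : ℝ → ℝ → ℝ}

lemma smooth₂_massDens (ha : Smooth₂ a) (hb : Smooth₂ b) : Smooth₂ (massDens a b) :=
  (ha.pow 2).add (hb.pow 2)

lemma smooth₂_gradDens (ha : Smooth₂ a) (hb : Smooth₂ b) : Smooth₂ (gradDens a b) :=
  (ha.pdx.pow 2).add (hb.pdx.pow 2)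

lemma smooth₂_momDens (ha : Smooth₂ a) (hb : Smooth₂ b) : Smooth₂ (momDens a b) :=
  (ha.mul hb.pdx).sub (hb.mul ha.pdx)

lemma smooth₂_energyDens (ha : Smooth₂ a) (hb : Smooth₂ b) : Smooth₂ (energyDens a b) := by
  have h : energyDens a b = fun t x => massDens a b t x + gradDens a b t x * (1 / 2)
      + massDens a b t x ^ 2 * (1 / 4) := by
    ext t x; unfold energyDens; ring
  rw [h]
  exact ((smooth₂_massDens ha hb).add ((smooth₂_gradDens ha hb).mul (smooth₂_const _))).add
    (((smooth₂_massDens ha hb).pow 2).mul (smooth₂_const _))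

lemma pdx_massDens (ha : Smooth₂ a) (hb : Smooth₂ b) (t x : ℝ) :
    pdx (massDens a b) t x = 2 * (a t x * pdx a t x + b t x * pdx b t x) := by
  refine (HasDerivAt.deriv (((ha.hasDerivAt_x t x).pow 2).add
    ((hb.hasDerivAt_x t x).pow 2))).trans ?_
  simp; ring

lemma pdt_massDens (ha : Smooth₂ a) (hb : Smooth₂ b) (t x : ℝ) :
    pdt (massDens a b) t x = 2 * (a t x * pdt a t x + b t x * pdt b t x) := by
  refine (HasDerivAt.deriv (((ha.hasDerivAt_t t x).pow 2).add
    ((hb.hasDerivAt_t t x).pow 2))).trans ?_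
  simp; ring

lemma pdx_momDens (ha : Smooth₂ a) (hb : Smooth₂ b) (t x : ℝ) :
    pdx (momDens a b) t x = a t x * pdx (pdx b) t x - b t x * pdx (pdx a) t x := by
  refine (HasDerivAt.deriv (((ha.hasDerivAt_x t x).mul (hb.pdx.hasDerivAt_x t x)).sub
    ((hb.hasDerivAt_x t x).mul (ha.pdx.hasDerivAt_x t x)))).trans ?_
  ring

lemma pdt_momDens (ha : Smooth₂ a) (hb : Smooth₂ b) (t x : ℝ) :
    pdt (momDens a b) t x = pdt a t x * pdx b t x + a t x * pdx (pdt b) t x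
      - (pdt b t x * pdx a t x + b t x * pdx (pdt a) t x) := by
  refine (HasDerivAt.deriv (((ha.hasDerivAt_t t x).mul (hb.pdx.hasDerivAt_t t x)).sub
    ((hb.hasDerivAt_t t x).mul (ha.pdx.hasDerivAt_t t x)))).trans ?_
  rw [ha.pdt_pdx, hb.pdt_pdx]

lemma pdt_gradDens (ha : Smooth₂ a) (hb : Smooth₂ b) (t x : ℝ) :
    pdt (gradDens a b) t x
      = 2 * (pdx a t x * pdx (pdt a) t x + pdx b t x * pdx (pdt b) t x) := by
  rw [← ha.pdt_pdx, ← hb.pdt_pdx]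
  exact pdt_massDens ha.pdx hb.pdx t x

lemma pdt_energyDens (ha : Smooth₂ a) (hb : Smooth₂ b) (t x : ℝ) :
    pdt (energyDens a b) t x = 2 * (a t x * pdt a t x + b t x * pdt b t x)
      + (pdx a t x * pdx (pdt a) t x + pdx b t x * pdx (pdt b) t x)
      + massDens a b t x * (a t x * pdt a t x + b t x * pdt b t x) := by
  have hm := (smooth₂_massDens ha hb).hasDerivAt_t t x
  have hg := (smooth₂_gradDens ha hb).hasDerivAt_t t x
  refine (HasDerivAt.deriv ((hm.add (hg.div_const 2)).add ((hm.pow 2).div_const 4))).trans ?_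
  rw [pdt_massDens ha hb, pdt_gradDens ha hb]
  simp; ring

end smooth

namespace NLSPair

variable {T : ℝ} {a b : ℝ → ℝ → ℝ}

section slices

variable {t : ℝ}

lemma int_mass (h : NLSPair T a b) (ht : t ∈ Set.Icc 0 T) : Integrable (massDens a b t) :=
  (h.int_a t ht).add (h.int_b t ht)

lemma int_grad (h : NLSPair T a b) (ht : t ∈ Set.Icc 0 T) : Integrable (gradDens a b t) :=
  (h.int_ax t ht).add (h.int_bx t ht)

lemma int_mass_grad (h : NLSPair T a b) (ht : t ∈ Set.Icc 0 T) :
    Integrable fun x => massDens a b t x + gradDens a b t x :=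
  (h.int_mass ht).add (h.int_grad ht)

lemma tendsto_mass (h : NLSPair T a b) (ht : t ∈ Set.Icc 0 T) :
    Filter.Tendsto (massDens a b t) Filter.atBot (nhds 0) := by
  have := ((h.tendsto_a t ht).pow 2).add ((h.tendsto_b t ht).pow 2)
  rw [zero_pow two_ne_zero, add_zero] at this
  exact this

lemma abs_pdx_mass_le (h : NLSPair T a b) (t x : ℝ) :
    |pdx (massDens a b) t x| ≤ massDens a b t x + gradDens a b t x := by
  rw [pdx_massDens h.smooth_a h.smooth_b]
  unfold massDens gradDens
  rw [abs_le]
  constructor <;> nlinarith [sq_nonneg (a t x + pdx a t x), sq_nonneg (b t x - pdx b t x),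
    sq_nonneg (a t x - pdx a t x), sq_nonneg (b t x + pdx b t x)]

lemma int_pdx_mass (h : NLSPair T a b) (ht : t ∈ Set.Icc 0 T) :
    Integrable (pdx (massDens a b) t) :=
  ((h.int_mass ht).add (h.int_grad ht)).mono'
    ((smooth₂_massDens h.smooth_a h.smooth_b).pdx.continuous_x t).aestronglyMeasurable
    (Filter.Eventually.of_forall fun x => h.abs_pdx_mass_le t x)

lemma mass_le (h : NLSPair T a b) (ht : t ∈ Set.Icc 0 T) (x : ℝ) :
    massDens a b t x ≤ ∫ y, (massDens a b t y + gradDens a b t y) := by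
  have hs := smooth₂_massDens h.smooth_a h.smooth_b
  have hi := (h.int_mass ht).add (h.int_grad ht)
  have e := integral_Iic_of_hasDerivAt_of_tendsto' (a := x)
    (fun y _ => hs.hasDerivAt_x t y) (h.int_pdx_mass ht).integrableOn (h.tendsto_mass ht)
  rw [sub_zero] at e
  rw [← e]
  calc ∫ y in Set.Iic x, pdx (massDens a b) t y
      ≤ ∫ y in Set.Iic x, (massDens a b t y + gradDens a b t y) :=
        setIntegral_mono (h.int_pdx_mass ht).integrableOn hi.integrableOn
          fun y => (le_abs_self _).trans (h.abs_pdx_mass_le t y)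
    _ ≤ _ := setIntegral_le_integral hi (Filter.Eventually.of_forall fun y =>
        add_nonneg (massDens_nonneg _ _ _ _) (gradDens_nonneg _ _ _ _))

lemma int_mass_sq (h : NLSPair T a b) (ht : t ∈ Set.Icc 0 T) :
    Integrable fun x => massDens a b t x ^ 2 := by
  refine ((h.int_mass ht).const_mul (∫ y, (massDens a b t y + gradDens a b t y))).mono'
    (((smooth₂_massDens h.smooth_a h.smooth_b).continuous_x t).pow 2).aestronglyMeasurable
    (Filter.Eventually.of_forall fun x => ?_)
  rw [Real.norm_of_nonneg (sq_nonneg _), sq]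
  exact mul_le_mul_of_nonneg_right (h.mass_le ht x) (massDens_nonneg _ _ _ _)

lemma int_energy (h : NLSPair T a b) (ht : t ∈ Set.Icc 0 T) : Integrable (energyDens a b t) :=
  ((h.int_mass ht).add ((h.int_grad ht).div_const 2)).add ((h.int_mass_sq ht).div_const 4)

end slices

/-- The time increment of a solution is `O(τ)` in `L²` at a fixed initial time. -/
lemma increment_initial (h : NLSPair T a b) {c d K : ℝ} (hcd : Set.Icc c d ⊆ Set.Icc 0 T)
    (hK : ∀ t ∈ Set.Icc c d, ∫ x, (massDens a b t x + gradDens a b t x) ≤ K) :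
    ∃ A ≥ 0, ∀ τ > 0, c + τ ≤ d → ∀ r > 0,
      ∫ x in (-r)..r, ((a (c + τ) x - a c x) ^ 2 + (b (c + τ) x - b c x) ^ 2) ≤ A * τ ^ 2 := by
  rcases lt_or_ge d c with hdc | hdc
  · exact ⟨0, le_rfl, fun τ hτ h' => absurd h' (by linarith)⟩
  have hc : c ∈ Set.Icc c d := Set.left_mem_Icc.2 hdc
  have hK0 : 0 ≤ K := (integral_nonneg fun x =>
    add_nonneg (massDens_nonneg _ _ _ _) (gradDens_nonneg _ _ _ _)).trans (hK c hc)
  have ha := h.smooth_a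
  have hb := h.smooth_b
  set J : ℝ := ∫ x, (pdx (pdx a) c x ^ 2 + pdx (pdx b) c x ^ 2) with hJ
  have hJi : Integrable fun x => pdx (pdx a) c x ^ 2 + pdx (pdx b) c x ^ 2 :=
    (h.int_axx c (hcd hc)).add (h.int_bxx c (hcd hc))
  have hJ0 : 0 ≤ J := integral_nonneg fun x => by positivity
  refine ⟨Real.exp 1 * (2 * J + 2 * K ^ 2 * K), by positivity, fun τ hτ hτd r hr => ?_⟩
  have hsub : Set.Icc c (c + τ) ⊆ Set.Icc c d := Set.Icc_subset_Icc_right hτd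
  have hA := ha.sub (ha.freeze c)
  have hB := hb.sub (hb.freeze c)
  have hAx : ∀ t x, pdx (fun t x => a t x - a c x) t x = pdx a t x - pdx a c x := fun t x =>
    ((ha.hasDerivAt_x t x).sub (ha.hasDerivAt_x c x)).deriv
  have hBx : ∀ t x, pdx (fun t x => b t x - b c x) t x = pdx b t x - pdx b c x := fun t x =>
    ((hb.hasDerivAt_x t x).sub (hb.hasDerivAt_x c x)).deriv
  have hAxx : ∀ t x, pdx (pdx (fun t x => a t x - a c x)) t x
      = pdx (pdx a) t x - pdx (pdx a) c x := by
    have : pdx (fun t x => a t x - a c x) = fun t x => pdx a t x - pdx a c x := by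
      ext t x; exact hAx t x
    intro t x
    rw [this]
    exact ((ha.pdx.hasDerivAt_x t x).sub (ha.pdx.hasDerivAt_x c x)).deriv
  have hBxx : ∀ t x, pdx (pdx (fun t x => b t x - b c x)) t x
      = pdx (pdx b) t x - pdx (pdx b) c x := by
    have : pdx (fun t x => b t x - b c x) = fun t x => pdx b t x - pdx b c x := by
      ext t x; exact hBx t x
    intro t x
    rw [this]
    exact ((hb.pdx.hasDerivAt_x t x).sub (hb.pdx.hasDerivAt_x c x)).deriv
  have hAt : ∀ t x, pdt (fun t x => a t x - a c x) t x = pdt a t x := fun t x =>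
    ((ha.hasDerivAt_t t x).sub_const _).deriv
  have hBt : ∀ t x, pdt (fun t x => b t x - b c x) t x = pdt b t x := fun t x =>
    ((hb.hasDerivAt_t t x).sub_const _).deriv
  have key := balance_law_gronwall
    (G := massDens (fun t x => a t x - a c x) (fun t x => b t x - b c x))
    (F := fun t x => 2 * momDens (fun t x => a t x - a c x) (fun t x => b t x - b c x) t x)
    (h := fun t x => τ * (2 * (pdx (pdx a) c x ^ 2 + pdx (pdx b) c x ^ 2)
      + 2 * massDens a b t x ^ 2 * massDens a b t x))
    (c := c) (d := c + τ) (lam := 1 / τ) (K := 4 * K) (A := τ * (2 * J + 2 * K ^ 2 * K)) (m := 0)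
    (s := c) (t := c + τ) (smooth₂_massDens hA hB)
    ((smooth₂_const 2).mul (smooth₂_momDens hA hB)) (by positivity) (by positivity)
    (massDens_nonneg _ _) ?_ ?_ ?_ ?_ ?_ ⟨le_rfl, by linarith⟩ ⟨by linarith, le_rfl⟩ ?_ hr
  · refine key.trans (le_of_eq ?_)
    have : 1 / τ * |c + τ - c| = 1 := by
      rw [add_sub_cancel_left, abs_of_pos hτ]; field_simp
    rw [this, add_sub_cancel_left, abs_of_pos hτ]
    ring
  · intro t
    have c1 := ha.pdx.pdx.continuous_x c
    have c2 := hb.pdx.pdx.continuous_x c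
    have c3 := (smooth₂_massDens ha hb).continuous_x t
    fun_prop
  · intro t x
    have := massDens_nonneg a b t x
    positivity
  · intro t ht x
    have ht' := hcd (hsub ht)
    have hF : pdx (fun t x => 2 * momDens (fun t x => a t x - a c x)
        (fun t x => b t x - b c x) t x) t x
        = 2 * pdx (momDens (fun t x => a t x - a c x) (fun t x => b t x - b c x)) t x :=
      (((smooth₂_momDens hA hB).hasDerivAt_x t x).const_mul 2).deriv
    rw [hF, pdt_massDens hA hB, pdx_momDens hA hB, hAxx, hBxx, hAt, hBt, h.eq_a t ht',
      h.eq_b t ht']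
    generalize pdx (pdx a) t x = axx
    generalize pdx (pdx b) t x = bxx
    generalize pdx (pdx a) c x = αxx
    generalize pdx (pdx b) c x = βxx
    simp only [massDens]
    generalize a t x = a₁
    generalize b t x = b₁
    generalize a c x = α
    generalize b c x = β
    have aux : ∀ A g : ℝ, |2 * A * g| ≤ 1 / τ * A ^ 2 + τ * g ^ 2 := by
      intro A g
      have e1 : 1 / τ * A ^ 2 + τ * g ^ 2 - 2 * A * g = 1 / τ * (A - τ * g) ^ 2 := by
        field_simp; ring
      have e2 : 1 / τ * A ^ 2 + τ * g ^ 2 + 2 * A * g = 1 / τ * (A + τ * g) ^ 2 := by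
        field_simp; ring
      have p1 : 0 ≤ 1 / τ * (A - τ * g) ^ 2 := by positivity
      have p2 : 0 ≤ 1 / τ * (A + τ * g) ^ 2 := by positivity
      rw [abs_le]; constructor <;> linarith
    have e : 2 * ((a₁ - α) * (-bxx + (a₁ ^ 2 + b₁ ^ 2) * b₁)
        + (b₁ - β) * (axx - (a₁ ^ 2 + b₁ ^ 2) * a₁))
        + 2 * ((a₁ - α) * (bxx - βxx) - (b₁ - β) * (axx - αxx))
        = 2 * (a₁ - α) * (-βxx + (a₁ ^ 2 + b₁ ^ 2) * b₁)
          + 2 * (b₁ - β) * (αxx - (a₁ ^ 2 + b₁ ^ 2) * a₁) := by ring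
    rw [e]
    have q1 : (-βxx + (a₁ ^ 2 + b₁ ^ 2) * b₁) ^ 2
        ≤ 2 * βxx ^ 2 + 2 * ((a₁ ^ 2 + b₁ ^ 2) * b₁) ^ 2 := by
      nlinarith [sq_nonneg (βxx + (a₁ ^ 2 + b₁ ^ 2) * b₁)]
    have q2 : (αxx - (a₁ ^ 2 + b₁ ^ 2) * a₁) ^ 2
        ≤ 2 * αxx ^ 2 + 2 * ((a₁ ^ 2 + b₁ ^ 2) * a₁) ^ 2 := by
      nlinarith [sq_nonneg (αxx + (a₁ ^ 2 + b₁ ^ 2) * a₁)]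
    calc _ ≤ _ := abs_add_le _ _
      _ ≤ _ := add_le_add (aux _ _) (aux _ _)
      _ = 1 / τ * ((a₁ - α) ^ 2 + (b₁ - β) ^ 2) + τ * ((-βxx + (a₁ ^ 2 + b₁ ^ 2) * b₁) ^ 2
          + (αxx - (a₁ ^ 2 + b₁ ^ 2) * a₁) ^ 2) := by ring
      _ ≤ 1 / τ * ((a₁ - α) ^ 2 + (b₁ - β) ^ 2)
          + τ * (2 * βxx ^ 2 + 2 * ((a₁ ^ 2 + b₁ ^ 2) * b₁) ^ 2
            + (2 * αxx ^ 2 + 2 * ((a₁ ^ 2 + b₁ ^ 2) * a₁) ^ 2)) := by gcongr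
      _ = _ := by ring
  · intro t ht R hR
    have ht' := hsub ht
    refine intervalIntegral_le_of_le
      (g := fun x => 2 * (massDens a b t x + gradDens a b t x)
        + 2 * (massDens a b c x + gradDens a b c x)) ?_ ?_ ?_ ?_ ?_ hR
    · exact (((smooth₂_const 2).mul (smooth₂_momDens hA hB)).continuous_x t).abs
    · exact (((h.int_mass (hcd ht')).add (h.int_grad (hcd ht'))).const_mul 2).add
        (((h.int_mass (hcd hc)).add (h.int_grad (hcd hc))).const_mul 2)
    · intro x
      have := massDens_nonneg a b t x
      have := massDens_nonneg a b c x
      have := gradDens_nonneg a b t x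
      have := gradDens_nonneg a b c x
      positivity
    · intro x
      refine (abs_momDens_le _ _ _ _).trans ?_
      simp only [massDens, gradDens, hAx, hBx]
      nlinarith [sq_nonneg (a t x + a c x), sq_nonneg (b t x + b c x),
        sq_nonneg (pdx a t x + pdx a c x), sq_nonneg (pdx b t x + pdx b c x)]
    · rw [integral_add ((h.int_mass_grad (hcd ht')).const_mul 2)
        ((h.int_mass_grad (hcd hc)).const_mul 2), integral_const_mul, integral_const_mul]
      linarith [hK t ht', hK c hc]
  · intro t ht R hR
    have ht' := hsub ht
    have i1 := hJi.const_mul 2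
    have i2 := (h.int_mass (hcd ht')).const_mul (2 * K ^ 2)
    refine intervalIntegral_le_of_le
      (g := fun x => τ * (2 * (pdx (pdx a) c x ^ 2 + pdx (pdx b) c x ^ 2)
        + 2 * K ^ 2 * massDens a b t x)) ?_ ((i1.add i2).const_mul τ) ?_ ?_ ?_ hR
    · have c1 := ha.pdx.pdx.continuous_x c
      have c2 := hb.pdx.pdx.continuous_x c
      have c3 := (smooth₂_massDens ha hb).continuous_x t
      fun_prop
    · intro x
      have := massDens_nonneg a b t x
      positivity
    · intro x
      have h0 := massDens_nonneg a b t x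
      have h1 := (h.mass_le (hcd ht') x).trans (hK t ht')
      gcongr
    · rw [integral_const_mul, integral_add i1 i2, integral_const_mul, integral_const_mul]
      have : ∫ x, massDens a b t x ≤ K := by
        refine le_trans (integral_mono (h.int_mass (hcd ht'))
          ((h.int_mass (hcd ht')).add (h.int_grad (hcd ht'))) fun x => ?_) (hK t ht')
        exact le_add_of_nonneg_right (gradDens_nonneg a b t x)
      gcongr
  · intro R hR
    simp [massDens]

end NLSPair

namespace Smooth₂

variable {f g : ℝ → ℝ → ℝ}

lemma pdx_sub (hf : Smooth₂ f) (hg : Smooth₂ g) :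
    _root_.pdx (fun t x => f t x - g t x) = fun t x => _root_.pdx f t x - _root_.pdx g t x := by
  ext t x
  exact ((hf.hasDerivAt_x t x).sub (hg.hasDerivAt_x t x)).deriv

lemma pdt_sub (hf : Smooth₂ f) (hg : Smooth₂ g) :
    _root_.pdt (fun t x => f t x - g t x) = fun t x => _root_.pdt f t x - _root_.pdt g t x := by
  ext t x
  exact ((hf.hasDerivAt_t t x).sub (hg.hasDerivAt_t t x)).deriv

lemma pdt_shift (f : ℝ → ℝ → ℝ) (τ : ℝ) :
    _root_.pdt (fun t x => f (t + τ) x) = fun t x => _root_.pdt f (t + τ) x := by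
  ext t x
  exact deriv_comp_add_const (f := fun s => f s x) τ t

lemma pdx_shift (f : ℝ → ℝ → ℝ) (τ : ℝ) :
    _root_.pdx (fun t x => f (t + τ) x) = fun t x => _root_.pdx f (t + τ) x := rfl

lemma exists_continuous_slope (hf : Smooth₂ f) (t : ℝ) :
    ∃ Q : ℝ → ℝ → ℝ, Continuous (Function.uncurry Q) ∧
      (∀ τ x, f (t + τ) x - f t x = τ * Q τ x) ∧ ∀ x, Q 0 x = _root_.pdt f t x := by
  have hc := hf.pdt.continuous
  refine ⟨fun τ x => ∫ σ in (0 : ℝ)..1, _root_.pdt f (t + σ * τ) x, ?_, fun τ x => ?_,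
    fun x => by simp⟩
  · refine intervalIntegral.continuous_parametric_intervalIntegral_of_continuous'
      (f := fun (p : ℝ × ℝ) σ => _root_.pdt f (t + σ * p.1) p.2) ?_ 0 1
    exact hc.comp (f := fun q : (ℝ × ℝ) × ℝ => (t + q.2 * q.1.1, q.1.2)) (by fun_prop)
  · have hd : ∀ σ : ℝ, HasDerivAt (fun σ => f (t + σ * τ) x)
        (τ * _root_.pdt f (t + σ * τ) x) σ := by
      intro σ
      have h1 : HasDerivAt (fun σ : ℝ => t + σ * τ) τ σ := by
        simpa using ((hasDerivAt_id σ).mul_const τ).const_add t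
      rw [mul_comm]
      exact HasDerivAt.comp (h₂ := fun s => f s x) σ (hf.hasDerivAt_t _ x) h1
    have hcσ : Continuous fun σ : ℝ => τ * _root_.pdt f (t + σ * τ) x :=
      continuous_const.mul (hc.comp (f := fun σ : ℝ => (t + σ * τ, x)) (by fun_prop))
    have := intervalIntegral.integral_eq_sub_of_hasDerivAt (fun σ _ => hd σ)
      (hcσ.intervalIntegrable 0 1)
    rw [← intervalIntegral.integral_const_mul, this]
    simp

end Smooth₂

namespace NLSPair

variable {T : ℝ} {a b : ℝ → ℝ → ℝ}

/-- Time increments of a solution are `O(τ)` in `L²`, locally uniformly in time. -/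
lemma increment_bound (h : NLSPair T a b) {c d K : ℝ} (hcd : Set.Icc c d ⊆ Set.Icc 0 T)
    (hK : ∀ t ∈ Set.Icc c d, ∫ x, (massDens a b t x + gradDens a b t x) ≤ K) :
    ∃ A ≥ 0, ∀ τ > 0, ∀ t, c ≤ t → t + τ ≤ d → ∀ r > 0,
      ∫ x in (-r)..r, ((a (t + τ) x - a t x) ^ 2 + (b (t + τ) x - b t x) ^ 2) ≤ A * τ ^ 2 := by
  obtain ⟨A, hA0, hA⟩ := h.increment_initial hcd hK
  refine ⟨Real.exp (4 * K * (d - c)) * A, by positivity, fun τ hτ t hct htd r hr => ?_⟩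
  have hc : c ∈ Set.Icc c d := ⟨le_rfl, by linarith⟩
  have hK0 : 0 ≤ K := (integral_nonneg fun x =>
    add_nonneg (massDens_nonneg _ _ _ _) (gradDens_nonneg _ _ _ _)).trans (hK c hc)
  have ha := h.smooth_a
  have hb := h.smooth_b
  have hA' := (ha.shift τ).sub ha
  have hB' := (hb.shift τ).sub hb
  have key := balance_law_gronwall
    (G := massDens (fun t x => a (t + τ) x - a t x) (fun t x => b (t + τ) x - b t x))
    (F := fun t x => 2 * momDens (fun t x => a (t + τ) x - a t x)
      (fun t x => b (t + τ) x - b t x) t x)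
    (h := fun _ _ => 0) (c := c) (d := d - τ) (lam := 4 * K) (K := 4 * K) (A := 0)
    (m := A * τ ^ 2) (s := c) (t := t) (smooth₂_massDens hA' hB')
    ((smooth₂_const 2).mul (smooth₂_momDens hA' hB')) (by positivity) le_rfl
    (massDens_nonneg _ _) (fun _ => continuous_const) (fun _ _ => le_rfl) ?_ ?_ ?_
    ⟨le_rfl, by linarith⟩ ⟨hct, by linarith⟩ (hA τ hτ (by linarith)) hr
  · refine key.trans ?_
    rw [abs_of_nonneg (by linarith : 0 ≤ t - c), zero_mul, add_zero, ← mul_assoc]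
    gcongr
    linarith
  · intro t ht x
    have ht1 : t ∈ Set.Icc c d := ⟨ht.1, by linarith [ht.2]⟩
    have ht2 : t + τ ∈ Set.Icc c d := ⟨by linarith [ht.1], by linarith [ht.2]⟩
    have hF : pdx (fun t x => 2 * momDens (fun t x => a (t + τ) x - a t x)
        (fun t x => b (t + τ) x - b t x) t x) t x
        = 2 * pdx (momDens (fun t x => a (t + τ) x - a t x)
          (fun t x => b (t + τ) x - b t x)) t x :=
      (((smooth₂_momDens hA' hB').hasDerivAt_x t x).const_mul 2).deriv
    have m1 := (h.mass_le (hcd ht1) x).trans (hK t ht1)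
    have m2 := (h.mass_le (hcd ht2) x).trans (hK _ ht2)
    rw [hF, pdt_massDens hA' hB', pdx_momDens hA' hB', (ha.shift τ).pdx_sub ha,
      (hb.shift τ).pdx_sub hb, (ha.shift τ).pdx.pdx_sub ha.pdx, (hb.shift τ).pdx.pdx_sub hb.pdx,
      (ha.shift τ).pdt_sub ha, (hb.shift τ).pdt_sub hb]
    simp only [Smooth₂.pdx_shift, Smooth₂.pdt_shift]
    rw [h.eq_a t (hcd ht1), h.eq_b t (hcd ht1), h.eq_a _ (hcd ht2), h.eq_b _ (hcd ht2)]
    simp only [massDens] at m1 m2 ⊢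
    generalize pdx (pdx a) t x = axx
    generalize pdx (pdx b) t x = bxx
    generalize pdx (pdx a) (t + τ) x = αxx
    generalize pdx (pdx b) (t + τ) x = βxx
    generalize a t x = a₁ at *
    generalize b t x = b₁ at *
    generalize a (t + τ) x = α at *
    generalize b (t + τ) x = β at *
    have e : 2 * ((α - a₁) * (-βxx + (α ^ 2 + β ^ 2) * β - (-bxx + (a₁ ^ 2 + b₁ ^ 2) * b₁))
        + (β - b₁) * (αxx - (α ^ 2 + β ^ 2) * α - (axx - (a₁ ^ 2 + b₁ ^ 2) * a₁)))
        + 2 * ((α - a₁) * (βxx - bxx) - (β - b₁) * (αxx - axx))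
        = 2 * (α ^ 2 + β ^ 2 - (a₁ ^ 2 + b₁ ^ 2)) * ((α - a₁) * b₁ - (β - b₁) * a₁) := by ring
    rw [e]
    set G := (α - a₁) ^ 2 + (β - b₁) ^ 2 with hG
    have hG0 : 0 ≤ G := by positivity
    have p1 : (α ^ 2 + β ^ 2 - (a₁ ^ 2 + b₁ ^ 2)) ^ 2 ≤ 4 * K * G := by
      calc (α ^ 2 + β ^ 2 - (a₁ ^ 2 + b₁ ^ 2)) ^ 2
          ≤ G * ((α + a₁) ^ 2 + (β + b₁) ^ 2) := by
            rw [hG]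
            nlinarith [sq_nonneg ((α - a₁) * (β + b₁) - (β - b₁) * (α + a₁))]
        _ ≤ G * (4 * K) := by
            gcongr
            nlinarith [sq_nonneg (α - a₁), sq_nonneg (β - b₁)]
        _ = _ := by ring
    have p2 : ((α - a₁) * b₁ - (β - b₁) * a₁) ^ 2 ≤ K * G := by
      calc ((α - a₁) * b₁ - (β - b₁) * a₁) ^ 2
          ≤ G * (a₁ ^ 2 + b₁ ^ 2) := by
            rw [hG]
            nlinarith [sq_nonneg ((α - a₁) * a₁ + (β - b₁) * b₁)]
        _ ≤ G * K := by gcongr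
        _ = _ := by ring
    generalize α ^ 2 + β ^ 2 - (a₁ ^ 2 + b₁ ^ 2) = X at *
    generalize (α - a₁) * b₁ - (β - b₁) * a₁ = Y at *
    rw [abs_le]
    constructor <;> nlinarith [sq_nonneg (X + 2 * Y), sq_nonneg (X - 2 * Y)]
  · intro t ht R hR
    have ht1 : t ∈ Set.Icc c d := ⟨ht.1, by linarith [ht.2]⟩
    have ht2 : t + τ ∈ Set.Icc c d := ⟨by linarith [ht.1], by linarith [ht.2]⟩
    have i1 := (h.int_mass_grad (hcd ht1)).const_mul 2
    have i2 := (h.int_mass_grad (hcd ht2)).const_mul 2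
    refine intervalIntegral_le_of_le
      (g := fun x => 2 * (massDens a b t x + gradDens a b t x)
        + 2 * (massDens a b (t + τ) x + gradDens a b (t + τ) x)) ?_ (i1.add i2) ?_ ?_ ?_ hR
    · exact (((smooth₂_const 2).mul (smooth₂_momDens hA' hB')).continuous_x t).abs
    · intro x
      have := massDens_nonneg a b t x
      have := massDens_nonneg a b (t + τ) x
      have := gradDens_nonneg a b t x
      have := gradDens_nonneg a b (t + τ) x
      positivity
    · intro x
      refine (abs_momDens_le _ _ _ _).trans ?_
      simp only [massDens, gradDens, (ha.shift τ).pdx_sub ha, (hb.shift τ).pdx_sub hb,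
        Smooth₂.pdx_shift]
      nlinarith [sq_nonneg (a t x + a (t + τ) x), sq_nonneg (b t x + b (t + τ) x),
        sq_nonneg (pdx a t x + pdx a (t + τ) x), sq_nonneg (pdx b t x + pdx b (t + τ) x)]
    · rw [integral_add i1 i2, integral_const_mul, integral_const_mul]
      linarith [hK t ht1, hK _ ht2]
  · intro t ht R hR
    simp

lemma timeDeriv_bound (h : NLSPair T a b) {c d K : ℝ} (hlt : c < d)
    (hcd : Set.Icc c d ⊆ Set.Icc 0 T)
    (hK : ∀ t ∈ Set.Icc c d, ∫ x, (massDens a b t x + gradDens a b t x) ≤ K) :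
    ∃ A ≥ 0, ∀ t ∈ Set.Icc c d, ∀ r > 0,
      ∫ x in (-r)..r, (pdt a t x ^ 2 + pdt b t x ^ 2) ≤ A := by
  obtain ⟨A, hA0, hA⟩ := h.increment_bound hcd hK
  refine ⟨A, hA0, fun t ht r hr => ?_⟩
  have ha := h.smooth_a
  have hb := h.smooth_b
  have hIco : ∀ t ∈ Set.Ico c d, ∫ x in (-r)..r, (pdt a t x ^ 2 + pdt b t x ^ 2) ≤ A := by
    intro t ht
    obtain ⟨Q, hQc, hQ, hQ0⟩ := ha.exists_continuous_slope t
    obtain ⟨S, hSc, hS, hS0⟩ := hb.exists_continuous_slope t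
    have hcont : Continuous fun τ => ∫ x in (-r)..r, (Q τ x ^ 2 + S τ x ^ 2) :=
      intervalIntegral.continuous_parametric_intervalIntegral_of_continuous'
        (f := fun τ x => Q τ x ^ 2 + S τ x ^ 2)
        ((hQc.fun_pow 2).fun_add (hSc.fun_pow 2)) _ _
    have hlim : Filter.Tendsto (fun τ => ∫ x in (-r)..r, (Q τ x ^ 2 + S τ x ^ 2))
        (nhdsWithin 0 (Set.Ioi 0)) (nhds (∫ x in (-r)..r, (pdt a t x ^ 2 + pdt b t x ^ 2))) := by
      have := (hcont.tendsto 0).mono_left (nhdsWithin_le_nhds (s := Set.Ioi 0))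
      simpa only [hQ0, hS0] using this
    refine le_of_tendsto hlim ?_
    filter_upwards [Ioo_mem_nhdsGT (sub_pos.2 ht.2)] with τ hτ
    have h1 := hA τ hτ.1 t ht.1 (by linarith [hτ.2]) r hr
    simp only [hQ, hS] at h1
    have e : ∀ x, (τ * Q τ x) ^ 2 + (τ * S τ x) ^ 2 = τ ^ 2 * (Q τ x ^ 2 + S τ x ^ 2) :=
      fun x => by ring
    simp only [e, intervalIntegral.integral_const_mul] at h1
    rw [mul_comm] at h1
    exact le_of_mul_le_mul_right h1 (pow_pos hτ.1 2)
  have hcont : Continuous fun t => ∫ x in (-r)..r, (pdt a t x ^ 2 + pdt b t x ^ 2) :=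
    intervalIntegral.continuous_parametric_intervalIntegral_of_continuous'
      (f := fun t x => pdt a t x ^ 2 + pdt b t x ^ 2)
      ((ha.pdt.pow 2).add (hb.pdt.pow 2)).continuous _ _
  have hcl : IsClosed {t | ∫ x in (-r)..r, (pdt a t x ^ 2 + pdt b t x ^ 2) ≤ A} :=
    isClosed_le hcont continuous_const
  have := closure_minimal (s := Set.Ico c d) hIco hcl
  rw [closure_Ico hlt.ne] at this
  exact this ht

lemma pdt_mass_add (h : NLSPair T a b) {t : ℝ} (ht : t ∈ Set.Icc 0 T) (x : ℝ) :
    pdt (massDens a b) t x = -(2 * pdx (momDens a b) t x) := by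
  rw [pdt_massDens h.smooth_a h.smooth_b, pdx_momDens h.smooth_a h.smooth_b, h.eq_a t ht,
    h.eq_b t ht]
  ring

/-- Mass is conserved as long as the `H¹` norm is bounded. -/
lemma mass_le_of_bound (h : NLSPair T a b) {c d K : ℝ} (hcd : Set.Icc c d ⊆ Set.Icc 0 T)
    (hK : ∀ t ∈ Set.Icc c d, ∫ x, (massDens a b t x + gradDens a b t x) ≤ K)
    {s t : ℝ} (hs : s ∈ Set.Icc c d) (ht : t ∈ Set.Icc c d) :
    ∫ x, massDens a b t x ≤ ∫ x, massDens a b s x := by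
  have ha := h.smooth_a
  have hb := h.smooth_b
  refine integral_le_of_intervalIntegral_le (h.int_mass (hcd ht)) fun r hr => ?_
  have key := balance_law_gronwall (G := massDens a b) (F := fun t x => 2 * momDens a b t x)
    (h := fun _ _ => 0) (c := c) (d := d) (lam := 0) (K := K) (A := 0)
    (m := ∫ x, massDens a b s x) (s := s) (t := t) (smooth₂_massDens ha hb)
    ((smooth₂_const 2).mul (smooth₂_momDens ha hb)) le_rfl le_rfl (massDens_nonneg _ _)
    (fun _ => continuous_const) (fun _ _ => le_rfl) ?_ ?_ (by simp) hs ht ?_ hr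
  · simpa using key
  · intro t ht x
    have hF : pdx (fun t x => 2 * momDens a b t x) t x = 2 * pdx (momDens a b) t x :=
      (((smooth₂_momDens ha hb).hasDerivAt_x t x).const_mul 2).deriv
    rw [hF, h.pdt_mass_add (hcd ht)]
    simp
  · intro t ht R hR
    exact intervalIntegral_le_of_le
      (((smooth₂_const 2).mul (smooth₂_momDens ha hb)).continuous_x t).abs
      (h.int_mass_grad (hcd ht))
      (fun x => add_nonneg (massDens_nonneg _ _ _ _) (gradDens_nonneg _ _ _ _))
      (fun x => abs_momDens_le _ _ _ _) (hK t ht) hR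
  · intro R hR
    exact intervalIntegral_le_of_le ((smooth₂_massDens ha hb).continuous_x s)
      (h.int_mass (hcd hs)) (massDens_nonneg _ _ _) (fun x => le_rfl) le_rfl hR

/-- Energy (plus mass) is conserved as long as the `H¹` norm is bounded. -/
lemma energy_le_of_bound (h : NLSPair T a b) {c d K : ℝ} (hcd : Set.Icc c d ⊆ Set.Icc 0 T)
    (hK : ∀ t ∈ Set.Icc c d, ∫ x, (massDens a b t x + gradDens a b t x) ≤ K)
    {s t : ℝ} (hs : s ∈ Set.Icc c d) (ht : t ∈ Set.Icc c d) :
    ∫ x, energyDens a b t x ≤ ∫ x, energyDens a b s x := by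
  rcases (hs.1.trans hs.2).eq_or_lt with heq | hlt
  · have : s = t := by
      have := hs.1; have := hs.2; have := ht.1; have := ht.2
      linarith
    rw [this]
  obtain ⟨A, hA0, hA⟩ := h.timeDeriv_bound hlt hcd hK
  have ha := h.smooth_a
  have hb := h.smooth_b
  refine integral_le_of_intervalIntegral_le (h.int_energy (hcd ht)) fun r hr => ?_
  have hFs : Smooth₂ fun t x => 2 * momDens a b t x
      - (pdx a t x * pdt a t x + pdx b t x * pdt b t x) :=
    ((smooth₂_const 2).mul (smooth₂_momDens ha hb)).sub
      ((ha.pdx.mul ha.pdt).add (hb.pdx.mul hb.pdt))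
  have key := balance_law_gronwall (G := energyDens a b)
    (F := fun t x => 2 * momDens a b t x - (pdx a t x * pdt a t x + pdx b t x * pdt b t x))
    (h := fun _ _ => 0) (c := c) (d := d) (lam := 0) (K := 2 * K + A) (A := 0)
    (m := ∫ x, energyDens a b s x) (s := s) (t := t) (smooth₂_energyDens ha hb)
    hFs le_rfl le_rfl (energyDens_nonneg _ _)
    (fun _ => continuous_const) (fun _ _ => le_rfl) ?_ ?_ (by simp) hs ht ?_ hr
  · simpa using key
  · intro t ht x
    have hF : pdx (fun t x => 2 * momDens a b t x
        - (pdx a t x * pdt a t x + pdx b t x * pdt b t x)) t x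
        = 2 * pdx (momDens a b) t x - ((pdx (pdx a) t x * pdt a t x + pdx a t x * pdx (pdt a) t x)
          + (pdx (pdx b) t x * pdt b t x + pdx b t x * pdx (pdt b) t x)) :=
      ((((smooth₂_momDens ha hb).hasDerivAt_x t x).const_mul 2).sub
        (((ha.pdx.hasDerivAt_x t x).mul (ha.pdt.hasDerivAt_x t x)).add
          ((hb.pdx.hasDerivAt_x t x).mul (hb.pdt.hasDerivAt_x t x)))).deriv
    rw [hF, pdt_energyDens ha hb, pdx_momDens ha hb, h.eq_a t (hcd ht), h.eq_b t (hcd ht)]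
    unfold massDens
    refine le_of_eq ?_
    rw [zero_mul, zero_add, abs_eq_zero]
    ring
  · intro t ht R hR
    have i1 := (ha.pdt.continuous_x t)
    have i2 := (hb.pdt.continuous_x t)
    have i3 := (smooth₂_massDens ha hb).continuous_x t
    have i4 := (smooth₂_gradDens ha hb).continuous_x t
    have hle : -R ≤ R := by linarith
    have c1 : Continuous fun x => 2 * (massDens a b t x + gradDens a b t x) := by fun_prop
    have c2 : Continuous fun x => pdt a t x ^ 2 + pdt b t x ^ 2 := by fun_prop
    calc ∫ x in (-R)..R, |2 * momDens a b t x
          - (pdx a t x * pdt a t x + pdx b t x * pdt b t x)|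
        ≤ ∫ x in (-R)..R, (2 * (massDens a b t x + gradDens a b t x)
            + (pdt a t x ^ 2 + pdt b t x ^ 2)) := by
          refine intervalIntegral.integral_mono hle
            ((hFs.continuous_x t).abs.intervalIntegrable _ _)
            ((c1.add c2).intervalIntegrable _ _) fun x => ?_
          have h1 := abs_le.1 (abs_momDens_le a b t x)
          have h2 := massDens_nonneg a b t x
          have h3 : gradDens a b t x = pdx a t x ^ 2 + pdx b t x ^ 2 := rfl
          show |_| ≤ _
          rw [abs_le]
          constructor <;> nlinarith [sq_nonneg (pdx a t x - pdt a t x),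
            sq_nonneg (pdx a t x + pdt a t x), sq_nonneg (pdx b t x - pdt b t x),
            sq_nonneg (pdx b t x + pdt b t x), h1.1, h1.2]
      _ = (∫ x in (-R)..R, 2 * (massDens a b t x + gradDens a b t x))
            + ∫ x in (-R)..R, (pdt a t x ^ 2 + pdt b t x ^ 2) :=
          integral_add_of_continuous c1 c2
      _ ≤ 2 * K + A := by
          refine add_le_add ?_ (hA t ht R hR)
          rw [intervalIntegral.integral_const_mul]
          have := intervalIntegral_le_of_le (i3.add i4) (h.int_mass_grad (hcd ht))
            (fun x => add_nonneg (massDens_nonneg _ _ _ _) (gradDens_nonneg _ _ _ _))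
            (fun x => le_rfl) (hK t ht) hR
          gcongr
          exact this
  · intro R hR
    exact intervalIntegral_le_of_le ((smooth₂_energyDens ha hb).continuous_x s)
      (h.int_energy (hcd hs)) (energyDens_nonneg _ _ _) (fun x => le_rfl) le_rfl hR

end NLSPair

section baire

variable {P : ℝ → ℝ}

lemma exists_bound_of_locally_bounded {s : Set ℝ} (hs : IsCompact s)
    (h : ∀ t ∈ s, ∃ K, ∀ᶠ τ in nhds t, P τ ≤ K) : ∃ K, ∀ t ∈ s, P t ≤ K := by
  refine hs.induction_on (p := fun s => ∃ K, ∀ t ∈ s, P t ≤ K) ⟨0, by simp⟩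
    (fun u v huv ⟨K, hK⟩ => ⟨K, fun t ht => hK t (huv ht)⟩) ?_ ?_
  · rintro u v ⟨K, hK⟩ ⟨L, hL⟩
    exact ⟨max K L, fun t ht => ht.elim (fun h => (hK t h).trans (le_max_left _ _))
      fun h => (hL t h).trans (le_max_right _ _)⟩
  · intro t ht
    obtain ⟨K, hK⟩ := h t ht
    exact ⟨{τ | P τ ≤ K}, mem_nhdsWithin_of_mem_nhds hK, K, fun τ hτ => hτ⟩

lemma le_across_gap (hcl : ∀ K, IsClosed {t | P t ≤ K})
    (hconst : ∀ c d K, (∀ τ ∈ Set.uIcc c d, P τ ≤ K) → P d ≤ P c) {y t : ℝ} (hyt : y ≠ t)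
    (hloc : ∀ s ∈ Set.uIcc y t, s ≠ y → ∃ K, ∀ᶠ τ in nhds s, P τ ≤ K) : P t ≤ P y := by
  have h1 : ∀ s ∈ Set.uIcc y t, s ≠ y → P s ≤ P t := by
    intro s hs hsy
    have hne : ∀ τ ∈ Set.uIcc t s, τ ≠ y := by
      rintro τ hτ rfl
      rcases Set.mem_uIcc.1 hs with h | h <;> rcases Set.mem_uIcc.1 hτ with h' | h' <;>
        exact hsy (by linarith [h.1, h.2, h'.1, h'.2])
    obtain ⟨K, hK⟩ := exists_bound_of_locally_bounded (P := P) (isCompact_uIcc (a := t) (b := s))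
      fun τ hτ => hloc τ (Set.uIcc_subset_uIcc Set.right_mem_uIcc hs hτ) (hne τ hτ)
    exact hconst t s K hK
  have h2 : P y ≤ P t := by
    have hsub : openSegment ℝ y t ⊆ {τ | P τ ≤ P t} := by
      intro τ hτ
      refine h1 τ (segment_eq_uIcc y t ▸ openSegment_subset_segment ℝ y t hτ) ?_
      rintro rfl
      exact hyt (left_mem_openSegment_iff.1 hτ)
    have := closure_minimal hsub (hcl _)
    rw [closure_openSegment] at this
    exact this (left_mem_segment ℝ y t)
  refine hconst y t (P t) fun τ hτ => ?_
  by_cases hy : τ = y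
  · rw [hy]; exact h2
  · exact h1 τ hτ hy

/-- A lower semicontinuous function that is constant on each compact interval on which it is
bounded, is bounded on every compact set. -/
lemma exists_bound_of_const_of_bound (hcl : ∀ K, IsClosed {t | P t ≤ K})
    (hconst : ∀ c d K, (∀ τ ∈ Set.uIcc c d, P τ ≤ K) → P d ≤ P c) {s : Set ℝ}
    (hs : IsCompact s) : ∃ K, ∀ t ∈ s, P t ≤ K := by
  set U : Set ℝ := {t | ∃ K, ∀ᶠ τ in nhds t, P τ ≤ K} with hU
  have hUo : IsOpen U := by
    rw [isOpen_iff_eventually]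
    rintro t ⟨K, hK⟩
    exact (eventually_eventually_nhds.2 hK).mono fun τ hτ => ⟨K, hτ⟩
  suffices hall : ∀ t, t ∈ U from exists_bound_of_locally_bounded hs fun t _ => hall t
  by_contra! hne
  obtain ⟨z, hz⟩ := hne
  have hBc : IsClosed Uᶜ := hUo.isClosed_compl
  have : CompleteSpace ↥Uᶜ := hBc.completeSpace_coe
  have : Nonempty ↥Uᶜ := ⟨⟨z, hz⟩⟩
  obtain ⟨n, x, hx⟩ := nonempty_interior_of_iUnion_of_closed
    (f := fun n : ℕ => {t : ↥Uᶜ | P t ≤ n})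
    (fun n => (hcl n).preimage continuous_subtype_val)
    (Set.eq_univ_of_forall fun t => Set.mem_iUnion.2 (exists_nat_ge (P t)))
  obtain ⟨ε, hε, hball⟩ := Metric.mem_nhds_iff.1 (mem_interior_iff_mem_nhds.1 hx)
  refine x.2 ⟨n, Metric.eventually_nhds_iff.2 ⟨ε, hε, fun t ht => ?_⟩⟩
  have hB : ∀ y, y ∉ U → dist y x < ε → P y ≤ n := fun y hy hyx =>
    hball (show (⟨y, hy⟩ : ↥Uᶜ) ∈ Metric.ball x ε from hyx)
  by_cases htU : t ∉ U
  · exact hB t htU ht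
  rw [not_not] at htU
  obtain ⟨y, ⟨hyB, hyI⟩, hmin⟩ := (isCompact_uIcc (a := (x : ℝ)) (b := t)).inter_left hBc
    |>.exists_isMinOn ⟨x, x.2, Set.left_mem_uIcc⟩ (continuous_id.dist continuous_const).continuousOn
      (f := fun y => dist y t)
  have hyt : y ≠ t := by
    rintro rfl
    exact hyB htU
  refine (le_across_gap hcl hconst hyt fun s hs hsy => ?_).trans (hB y hyB ?_)
  · by_contra hsU
    have h1 : dist y t ≤ dist s t := hmin ⟨hsU, Set.uIcc_subset_uIcc hyI Set.right_mem_uIcc hs⟩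
    rw [Real.dist_eq, Real.dist_eq] at h1
    rcases Set.mem_uIcc.1 hs with h | h
    · rw [abs_of_nonpos (by linarith [h.1, h.2]), abs_of_nonpos (by linarith [h.1, h.2])] at h1
      exact hsy (le_antisymm (by linarith) h.1)
    · rw [abs_of_nonneg (by linarith [h.1, h.2]), abs_of_nonneg (by linarith [h.1, h.2])] at h1
      exact hsy (le_antisymm h.2 (by linarith))
  · refine lt_of_le_of_lt ?_ ht
    rw [Real.dist_eq, Real.dist_eq]
    exact Set.abs_sub_left_of_mem_uIcc hyI

end baire

namespace NLSPair

variable {T : ℝ} {a b : ℝ → ℝ → ℝ}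

lemma mass_grad_le_energy (h : NLSPair T a b) {t : ℝ} (ht : t ∈ Set.Icc 0 T) :
    ∫ x, (massDens a b t x + gradDens a b t x) ≤ 2 * ∫ x, energyDens a b t x := by
  rw [← integral_const_mul]
  refine integral_mono (h.int_mass_grad ht) ((h.int_energy ht).const_mul 2) fun x => ?_
  have := massDens_nonneg a b t x
  simp only [energyDens]
  nlinarith [sq_nonneg (massDens a b t x)]

/-- The `H¹` norm of a solution is bounded on `[0, T]`. -/
lemma exists_bound (h : NLSPair T a b) (hT : 0 ≤ T) :
    ∃ K, ∀ t ∈ Set.Icc 0 T, ∫ x, (massDens a b t x + gradDens a b t x) ≤ K := by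
  have hs := smooth₂_energyDens h.smooth_a h.smooth_b
  set cl : ℝ → ℝ := fun t => (Set.projIcc 0 T hT t : ℝ) with hcl
  have hclc : Continuous cl := continuous_subtype_val.comp continuous_projIcc
  have hclm : ∀ t, cl t ∈ Set.Icc 0 T := fun t => (Set.projIcc 0 T hT t).2
  have hmono : Monotone cl := fun s t hst => Set.monotone_projIcc hT hst
  have key := exists_bound_of_const_of_bound (P := fun t => ∫ x, energyDens a b (cl t) x)
    (s := Set.Icc 0 T) ?_ ?_ isCompact_Icc
  · obtain ⟨K, hK⟩ := key
    refine ⟨2 * K, fun t ht => (h.mass_grad_le_energy ht).trans ?_⟩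
    have := hK t ht
    simp only [hcl, Set.projIcc_of_mem hT ht] at this
    gcongr
  · intro K
    have : {t | ∫ x, energyDens a b (cl t) x ≤ K}
        = ⋂ r : Set.Ioi (0 : ℝ), {t | ∫ x in (-r : ℝ)..r, energyDens a b (cl t) x ≤ K} := by
      ext t
      simp only [Set.mem_ofPred_eq, Set.mem_iInter]
      constructor
      · intro hK r
        exact intervalIntegral_le_of_le (hs.continuous_x _) (h.int_energy (hclm t))
          (energyDens_nonneg _ _ _) (fun x => le_rfl) hK r.2
      · intro hK
        exact integral_le_of_intervalIntegral_le (h.int_energy (hclm t)) fun r hr => hK ⟨r, hr⟩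
    rw [this]
    refine isClosed_iInter fun r => isClosed_le ?_ continuous_const
    exact (intervalIntegral.continuous_parametric_intervalIntegral_of_continuous'
      hs.continuous _ _).comp hclc
  · intro c d K hK
    have hK' : ∀ t ∈ Set.uIcc (cl c) (cl d), ∫ x, energyDens a b t x ≤ K := by
      intro t ht
      have hcont : Set.uIcc (cl c) (cl d) ⊆ cl '' Set.uIcc c d :=
        intermediate_value_uIcc hclc.continuousOn
      obtain ⟨τ, hτ, rfl⟩ := hcont ht
      exact hK τ hτ
    have hsub : Set.uIcc (cl c) (cl d) ⊆ Set.Icc 0 T :=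
      Set.OrdConnected.uIcc_subset Set.ordConnected_Icc (hclm c) (hclm d)
    exact h.energy_le_of_bound (K := 2 * K) hsub
      (fun t ht => (h.mass_grad_le_energy (hsub ht)).trans
        (by have := hK' t ht; gcongr)) Set.left_mem_uIcc Set.right_mem_uIcc

end NLSPair

/-- Cauchy–Schwarz inequality for a function dominated by a geometric mean. -/
lemma integral_sq_le_of_sq_le_mul {f u v : ℝ → ℝ} (hf : Integrable f) (hu : Integrable u)
    (hv : Integrable v) (hu0 : ∀ x, 0 ≤ u x) (hv0 : ∀ x, 0 ≤ v x)
    (h : ∀ x, f x ^ 2 ≤ u x * v x) : (∫ x, f x) ^ 2 ≤ (∫ x, u x) * ∫ x, v x := by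
  have key : ∀ l : ℝ, 0 ≤ (∫ x, u x) * (l * l) + (-2 * ∫ x, f x) * l + ∫ x, v x := by
    intro l
    have i1 : Integrable fun x => u x * (l * l) := hu.mul_const _
    have i2 : Integrable fun x => (-2 * f x) * l := (hf.const_mul _).mul_const _
    have i3 : Integrable fun x => u x * (l * l) + (-2 * f x) * l := i1.add i2
    have e : ∫ x, (u x * (l * l) + (-2 * f x) * l + v x)
        = (∫ x, u x) * (l * l) + (-2 * ∫ x, f x) * l + ∫ x, v x := by
      rw [integral_add i3 hv, integral_add i1 i2, integral_mul_const, integral_mul_const,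
        integral_const_mul]
    rw [← e]
    refine integral_nonneg fun x => ?_
    show 0 ≤ u x * (l * l) + (-2 * f x) * l + v x
    rcases (hu0 x).eq_or_lt with hx | hx
    · have : f x = 0 := by
        have := h x
        rw [← hx, zero_mul] at this
        exact pow_eq_zero_iff two_ne_zero |>.1 (le_antisymm this (sq_nonneg _))
      rw [this, ← hx]
      simpa using hv0 x
    · refine nonneg_of_mul_nonneg_right (a := u x) ?_ hx
      nlinarith [sq_nonneg (l * u x - f x), h x]
  have := discrim_le_zero key
  rw [discrim] at this
  nlinarith

section primitive

/-- The primitive in space of a localized function. -/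
def cutoffPrim (R : ℝ) (f : ℝ → ℝ → ℝ) (t x : ℝ) : ℝ :=
  ∫ y in (-R)..x, cutoff R y * f t y

variable {f : ℝ → ℝ → ℝ} {R : ℝ}

lemma continuous_cutoffPrim (hf : Smooth₂ f) :
    Continuous (Function.uncurry (cutoffPrim R f)) := by
  have h := ((smooth₂_cutoff R).mul hf).continuous
  refine intervalIntegral.continuous_parametric_intervalIntegral_of_continuous
    (f := fun (p : ℝ × ℝ) y => cutoff R y * f p.1 y) (s := fun p : ℝ × ℝ => p.2) ?_ continuous_snd
  exact h.comp (f := fun q : (ℝ × ℝ) × ℝ => (q.1.1, q.2)) (by fun_prop)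

lemma hasDerivAt_cutoffPrim_x (hf : Smooth₂ f) (t x : ℝ) :
    HasDerivAt (cutoffPrim R f t) (cutoff R x * f t x) x := by
  have hc : Continuous fun y => cutoff R y * f t y :=
    (continuous_cutoff R).mul (hf.continuous_x t)
  exact intervalIntegral.integral_hasDerivAt_right (hc.intervalIntegrable _ _)
    (hc.stronglyMeasurableAtFilter _ _) hc.continuousAt

lemma hasDerivAt_cutoffPrim_t (hf : Smooth₂ f) (t x : ℝ) :
    HasDerivAt (fun s => cutoffPrim R f s x) (cutoffPrim R (pdt f) t x) t :=
  hasDerivAt_intervalIntegral_of_continuous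
    (G := fun s x => cutoff R x * f s x) (G' := fun s x => cutoff R x * pdt f s x)
    ((smooth₂_cutoff R).mul hf).continuous ((smooth₂_cutoff R).mul hf.pdt).continuous
    (fun t x => (hf.hasDerivAt_t t x).const_mul _) t

lemma abs_cutoffPrim_le (hf : Smooth₂ f) (hf0 : ∀ t x, 0 ≤ f t x) (hR : 0 < R) {t m : ℝ}
    (hm : ∀ r > 0, ∫ x in (-r)..r, f t x ≤ m) {x : ℝ} (hx : x ∈ Set.Icc (-R) R) :
    |2 * cutoffPrim R f t x - cutoffPrim R f t R| ≤ m := by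
  have hle : -R ≤ R := by linarith
  have hc : Continuous fun y => cutoff R y * f t y :=
    (continuous_cutoff R).mul (hf.continuous_x t)
  have h0 : ∀ y, 0 ≤ cutoff R y * f t y := fun y => mul_nonneg (cutoff_nonneg R y) (hf0 t y)
  have h1 : 0 ≤ cutoffPrim R f t x := intervalIntegral.integral_nonneg hx.1 fun y _ => h0 y
  have h2 : cutoffPrim R f t x ≤ cutoffPrim R f t R :=
    intervalIntegral.integral_mono_interval le_rfl hx.1 hx.2
      (Filter.Eventually.of_forall h0) (hc.intervalIntegrable _ _)
  have h3 : cutoffPrim R f t R ≤ m := by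
    refine le_trans (intervalIntegral.integral_mono_on hle (hc.intervalIntegrable _ _)
      ((hf.continuous_x t).intervalIntegrable _ _) fun y hy => ?_) (hm R hR)
    exact mul_le_of_le_one_left (hf0 t y) (cutoff_le_one hR hy)
  rw [abs_le]
  constructor <;> linarith

end primitive

/-- The lower bound for the time derivative of the localized interaction Morawetz action, at a
fixed time. Here `ρ`, `g`, `p`, `q` are the densities of mass, gradient, momentum, and half the
derivative of the mass density. -/
lemma morawetz_slice {R K : ℝ} (hR : 1 ≤ R) (hK : 0 ≤ K) {Φ Φt ρ g p pt q q' : ℝ → ℝ}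
    (hΦ : ∀ x, HasDerivAt Φ (2 * (cutoff R x * ρ x)) x)
    (hρ : ∀ x, HasDerivAt ρ (2 * q x) x) (hq : ∀ x, HasDerivAt q (q' x) x)
    (hS : ∀ x, HasDerivAt (fun x => q' x - (2 * g x + ρ x ^ 2 / 2)) (pt x) x)
    (cpt : Continuous pt) (cg : Continuous g) (cq' : Continuous q') (cp : Continuous p)
    (cΦt : Continuous Φt)
    (hΦK : ∀ x ∈ Set.Icc (-R) R, |Φ x| ≤ K)
    (hΦt : ∀ x ∈ Set.Icc (-R) R, |Φt x + 4 * (cutoff R x * p x)| ≤ 12 * K / R)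
    (hρ0 : ∀ x, 0 ≤ ρ x) (hρK : ∀ x, ρ x ≤ K) (hg0 : ∀ x, 0 ≤ g x)
    (hpq : ∀ x, ρ x * g x = p x ^ 2 + q x ^ 2)
    (hp : ∀ x, |2 * p x| ≤ ρ x + g x) (hq2 : ∀ x, |2 * q x| ≤ ρ x + g x)
    (hInt : ∫ x in (-R)..R, (ρ x + g x) ≤ K) :
    (∫ x in (-R)..R, cutoff R x ^ 2 * (8 * q x ^ 2)) - (30 * K + 2 * K ^ 2) / R * K
      ≤ ∫ x in (-R)..R, cutoff R x * (pt x * Φ x + p x * Φt x) := by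
  have hR0 : 0 < R := by linarith
  have hle : -R ≤ R := by linarith
  have cχ := continuous_cutoff R
  have cχ' := continuous_cutoffDeriv R
  have cχ'' := continuous_cutoffDeriv₂ R
  have cΦ : Continuous Φ := continuous_iff_continuousAt.2 fun x => (hΦ x).continuousAt
  have cρ : Continuous ρ := continuous_iff_continuousAt.2 fun x => (hρ x).continuousAt
  have cq : Continuous q := continuous_iff_continuousAt.2 fun x => (hq x).continuousAt
  set V : ℝ → ℝ := fun x => cutoffDeriv R x * Φ x + cutoff R x * (2 * (cutoff R x * ρ x)) with hV
  set V' : ℝ → ℝ := fun x => cutoffDeriv₂ R x * Φ x + 6 * cutoff R x * cutoffDeriv R x * ρ x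
    + 4 * cutoff R x ^ 2 * q x with hV'
  have hVd : ∀ x, HasDerivAt V (V' x) x := fun x => by
    have h1 := (hasDerivAt_cutoffDeriv hR0 x).mul (hΦ x)
    have h2 := (hasDerivAt_cutoff hR0 x).mul
      (((hasDerivAt_cutoff hR0 x).mul (hρ x)).const_mul 2)
    refine (h1.add h2).congr_deriv ?_
    simp only [hV', Pi.mul_apply]
    ring
  have I1 : ∫ x in (-R)..R, (cutoff R x * Φ x) * pt x
      = -∫ x in (-R)..R, V x * (q' x - (2 * g x + ρ x ^ 2 / 2)) := by
    refine integral_mul_deriv_of_vanish (χ := fun x => cutoff R x * Φ x) (χ' := V)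
      (fun x => (hasDerivAt_cutoff hR0 x).mul (hΦ x)) (by fun_prop) ?_ ?_ hS cpt
    · rw [cutoff_left hR0, zero_mul]
    · rw [cutoff_right hR0, zero_mul]
  have I2 : ∫ x in (-R)..R, V x * q' x = -∫ x in (-R)..R, V' x * q x := by
    refine integral_mul_deriv_of_vanish hVd (by fun_prop) ?_ ?_ hq cq'
    · simp only [hV, cutoff_left hR0, cutoffDeriv_left hR0]; ring
    · simp only [hV, cutoff_right hR0, cutoffDeriv_right hR0]; ring
  have I3 : ∫ x in (-R)..R, cutoff R x * (pt x * Φ x + p x * Φt x)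
      = ∫ x in (-R)..R, (V x * (2 * g x + ρ x ^ 2 / 2) + V' x * q x
        + cutoff R x * p x * Φt x) := by
    have cV : Continuous V := by fun_prop
    have cV' : Continuous V' := by fun_prop
    have e1 : ∫ x in (-R)..R, V x * (q' x - (2 * g x + ρ x ^ 2 / 2))
        = (∫ x in (-R)..R, V x * q' x) + ∫ x in (-R)..R, -(V x * (2 * g x + ρ x ^ 2 / 2)) := by
      rw [← integral_add_of_continuous (f := fun x => V x * q' x) (by fun_prop) (by fun_prop)]
      congr 1; ext x; ring
    rw [intervalIntegral.integral_neg, I2] at e1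
    rw [integral_add_of_continuous (f := fun x => V x * (2 * g x + ρ x ^ 2 / 2) + V' x * q x)
      (by fun_prop) (by fun_prop),
      integral_add_of_continuous (f := fun x => V x * (2 * g x + ρ x ^ 2 / 2))
      (by fun_prop) (by fun_prop)]
    have e2 : ∫ x in (-R)..R, cutoff R x * (pt x * Φ x + p x * Φt x)
        = (∫ x in (-R)..R, (cutoff R x * Φ x) * pt x)
          + ∫ x in (-R)..R, cutoff R x * p x * Φt x := by
      rw [← integral_add_of_continuous (f := fun x => (cutoff R x * Φ x) * pt x)
        (by fun_prop) (by fun_prop)]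
      congr 1; ext x; ring
    rw [e2, I1, e1]
    ring
  have c1 : Continuous fun x => cutoff R x ^ 2 * (8 * q x ^ 2) := by fun_prop
  have c2 : Continuous fun x => (30 * K + 2 * K ^ 2) / R * (ρ x + g x) := by fun_prop
  calc (∫ x in (-R)..R, cutoff R x ^ 2 * (8 * q x ^ 2)) - (30 * K + 2 * K ^ 2) / R * K
      ≤ (∫ x in (-R)..R, cutoff R x ^ 2 * (8 * q x ^ 2))
        - (30 * K + 2 * K ^ 2) / R * ∫ x in (-R)..R, (ρ x + g x) := by gcongr
    _ = ∫ x in (-R)..R, (cutoff R x ^ 2 * (8 * q x ^ 2)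
          - (30 * K + 2 * K ^ 2) / R * (ρ x + g x)) := by
        rw [intervalIntegral.integral_sub (c1.intervalIntegrable _ _)
          (c2.intervalIntegrable _ _), intervalIntegral.integral_const_mul]
    _ ≤ _ := by
        rw [I3]
        refine intervalIntegral.integral_mono_on hle ((c1.sub c2).intervalIntegrable _ _)
          ((by fun_prop : Continuous _).intervalIntegrable _ _) fun x hx => ?_
        have hχ0 := cutoff_nonneg R x
        have hχ1 := cutoff_le_one hR0 hx
        have hχ' := abs_cutoffDeriv_le hR0 hx
        have hχ'' := abs_cutoffDeriv₂_le hR hx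
        have hΦx := hΦK x hx
        have hex := hΦt x hx
        have hpx : |p x| ≤ (ρ x + g x) / 2 := by
          have := hp x
          rw [abs_mul, abs_two] at this
          linarith
        have hqx : |q x| ≤ (ρ x + g x) / 2 := by
          have := hq2 x
          rw [abs_mul, abs_two] at this
          linarith
        have h0 := hρ0 x
        have h1 := hρK x
        have h2 := hg0 x
        have e1 : |cutoffDeriv R x * Φ x * (2 * g x + ρ x ^ 2 / 2)|
            ≤ 4 / R * K * (2 * g x + K * ρ x / 2) := by
          rw [abs_mul, abs_mul, abs_of_nonneg (by positivity : 0 ≤ 2 * g x + ρ x ^ 2 / 2), sq]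
          gcongr
        have e2 : |cutoffDeriv₂ R x * Φ x * q x| ≤ 8 / R * K * ((ρ x + g x) / 2) := by
          rw [abs_mul, abs_mul]
          gcongr
        have e3 : |cutoff R x * cutoffDeriv R x * ρ x * q x|
            ≤ 1 * (4 / R) * K * ((ρ x + g x) / 2) := by
          rw [abs_mul, abs_mul, abs_mul, abs_of_nonneg hχ0, abs_of_nonneg h0]
          gcongr
        have e4 : |cutoff R x * p x * (Φt x + 4 * (cutoff R x * p x))|
            ≤ 1 * ((ρ x + g x) / 2) * (12 * K / R) := by
          rw [abs_mul, abs_mul, abs_of_nonneg hχ0]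
          gcongr
        have e5 : 0 ≤ cutoff R x ^ 2 * ρ x ^ 3 := by positivity
        have e6 : V x * (2 * g x + ρ x ^ 2 / 2) + V' x * q x + cutoff R x * p x * Φt x
            = cutoffDeriv R x * Φ x * (2 * g x + ρ x ^ 2 / 2) + cutoffDeriv₂ R x * Φ x * q x
              + 6 * (cutoff R x * cutoffDeriv R x * ρ x * q x)
              + cutoff R x * p x * (Φt x + 4 * (cutoff R x * p x))
              + cutoff R x ^ 2 * ρ x ^ 3 + cutoff R x ^ 2 * (8 * q x ^ 2) := by
          simp only [hV, hV']
          linear_combination (4 * cutoff R x ^ 2) * hpq x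
        have e7 : 4 / R * K * (2 * g x + K * ρ x / 2) + 8 / R * K * ((ρ x + g x) / 2)
            + 6 * (1 * (4 / R) * K * ((ρ x + g x) / 2)) + 1 * ((ρ x + g x) / 2) * (12 * K / R)
            ≤ (30 * K + 2 * K ^ 2) / R * (ρ x + g x) := by
          have : (30 * K + 2 * K ^ 2) / R * (ρ x + g x)
              - (4 / R * K * (2 * g x + K * ρ x / 2) + 8 / R * K * ((ρ x + g x) / 2)
            + 6 * (1 * (4 / R) * K * ((ρ x + g x) / 2)) + 1 * ((ρ x + g x) / 2) * (12 * K / R))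
              = (8 * K * ρ x + 2 * K ^ 2 * g x) / R := by
            field_simp; ring
          have h3 : 0 ≤ (8 * K * ρ x + 2 * K ^ 2 * g x) / R := by positivity
          linarith
        rw [e6]
        linarith [(abs_le.1 e1).1, (abs_le.1 e2).1, (abs_le.1 e3).1, (abs_le.1 e4).1]

namespace NLSPair

variable {T : ℝ} {a b : ℝ → ℝ → ℝ}

lemma abs_momDens_le_half (a b : ℝ → ℝ → ℝ) (t x : ℝ) :
    |momDens a b t x| ≤ (massDens a b t x + gradDens a b t x) / 2 := by
  have := abs_momDens_le a b t x
  rw [abs_mul, abs_two] at this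
  linarith

/-- The local conservation law for the momentum. -/
lemma hasDerivAt_momentum_flux (h : NLSPair T a b) {t : ℝ} (ht : t ∈ Set.Icc 0 T) (x : ℝ) :
    HasDerivAt (fun x => (pdx a t x ^ 2 + a t x * pdx (pdx a) t x
        + (pdx b t x ^ 2 + b t x * pdx (pdx b) t x))
        - (2 * gradDens a b t x + massDens a b t x ^ 2 / 2)) (pdt (momDens a b) t x) x := by
  have a0 := h.smooth_a.hasDerivAt_x t x
  have a1 := h.smooth_a.pdx.hasDerivAt_x t x
  have a2 := h.smooth_a.pdx.pdx.hasDerivAt_x t x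
  have b0 := h.smooth_b.hasDerivAt_x t x
  have b1 := h.smooth_b.pdx.hasDerivAt_x t x
  have b2 := h.smooth_b.pdx.pdx.hasDerivAt_x t x
  have ea : pdx (pdt a) t x = -pdx (pdx (pdx b)) t x
      + ((2 * a t x * pdx a t x + 2 * b t x * pdx b t x) * b t x
        + (a t x ^ 2 + b t x ^ 2) * pdx b t x) := by
    have : pdt a t = fun x => -pdx (pdx b) t x + (a t x ^ 2 + b t x ^ 2) * b t x :=
      funext (h.eq_a t ht)
    rw [pdx, this]
    refine ((b2.fun_neg.fun_add
      (((a0.fun_pow 2).fun_add (b0.fun_pow 2)).fun_mul b0)).deriv).trans ?_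
    simp
  have eb : pdx (pdt b) t x = pdx (pdx (pdx a)) t x
      - ((2 * a t x * pdx a t x + 2 * b t x * pdx b t x) * a t x
        + (a t x ^ 2 + b t x ^ 2) * pdx a t x) := by
    have : pdt b t = fun x => pdx (pdx a) t x - (a t x ^ 2 + b t x ^ 2) * a t x :=
      funext (h.eq_b t ht)
    rw [pdx, this]
    refine ((a2.fun_sub (((a0.fun_pow 2).fun_add (b0.fun_pow 2)).fun_mul a0)).deriv).trans ?_
    simp
  have key := (((a1.fun_pow 2).fun_add (a0.fun_mul a2)).fun_add
    ((b1.fun_pow 2).fun_add (b0.fun_mul b2))).fun_sub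
    ((((a1.fun_pow 2).fun_add (b1.fun_pow 2)).const_mul 2).fun_add
      ((((a0.fun_pow 2).fun_add (b0.fun_pow 2)).fun_pow 2).div_const 2))
  refine key.congr_deriv ?_
  rw [pdt_momDens h.smooth_a h.smooth_b, ea, eb, h.eq_a t ht, h.eq_b t ht]
  simp
  ring

lemma abs_weightDeriv_add_le (h : NLSPair T a b) {R K t : ℝ} (hR : 0 < R)
    (ht : t ∈ Set.Icc 0 T) (hK : ∫ x, (massDens a b t x + gradDens a b t x) ≤ K)
    {x : ℝ} (hx : x ∈ Set.Icc (-R) R) :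
    |2 * cutoffPrim R (pdt (massDens a b)) t x - cutoffPrim R (pdt (massDens a b)) t R
      + 4 * (cutoff R x * momDens a b t x)| ≤ 12 * K / R := by
  have hp := smooth₂_momDens h.smooth_a h.smooth_b
  have hle : -R ≤ R := by linarith
  have hc' := continuous_cutoffDeriv R
  have hpc := hp.continuous_x t
  have hcc : Continuous fun y => cutoffDeriv R y * momDens a b t y := hc'.mul hpc
  have prim : ∀ x, cutoffPrim R (pdt (massDens a b)) t x
      = -2 * (cutoff R x * momDens a b t x)
        + 2 * ∫ y in (-R)..x, cutoffDeriv R y * momDens a b t y := by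
    intro x
    have e : ∀ y, cutoff R y * pdt (massDens a b) t y
        = -2 * (cutoff R y * pdx (momDens a b) t y) := fun y => by
      rw [h.pdt_mass_add ht]; ring
    simp only [cutoffPrim, e]
    rw [intervalIntegral.integral_const_mul,
      intervalIntegral.integral_mul_deriv_eq_deriv_mul (fun y _ => hasDerivAt_cutoff hR y)
        (fun y _ => hp.hasDerivAt_x t y) (hc'.intervalIntegrable _ _)
        ((hp.pdx.continuous_x t).intervalIntegrable _ _), cutoff_left hR]
    ring
  have bound : ∀ x ∈ Set.Icc (-R) R,
      |∫ y in (-R)..x, cutoffDeriv R y * momDens a b t y| ≤ 2 * K / R := by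
    intro x hx
    have hi : Continuous fun y => (massDens a b t y + gradDens a b t y) / 2 :=
      (((smooth₂_massDens h.smooth_a h.smooth_b).continuous_x t).add
        ((smooth₂_gradDens h.smooth_a h.smooth_b).continuous_x t)).div_const 2
    calc |∫ y in (-R)..x, cutoffDeriv R y * momDens a b t y|
        ≤ ∫ y in (-R)..x, |cutoffDeriv R y * momDens a b t y| :=
          intervalIntegral.abs_integral_le_integral_abs hx.1
      _ ≤ ∫ y in (-R)..R, |cutoffDeriv R y * momDens a b t y| :=
          intervalIntegral.integral_mono_interval le_rfl hx.1 hx.2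
            (Filter.Eventually.of_forall fun y => abs_nonneg _)
            (hcc.abs.intervalIntegrable _ _)
      _ ≤ ∫ y in (-R)..R, 4 / R * ((massDens a b t y + gradDens a b t y) / 2) := by
          refine intervalIntegral.integral_mono_on hle (hcc.abs.intervalIntegrable _ _)
            ((hi.const_mul _).intervalIntegrable _ _) fun y hy => ?_
          rw [abs_mul]
          exact mul_le_mul (abs_cutoffDeriv_le hR hy) (abs_momDens_le_half a b t y) (abs_nonneg _)
            (by positivity)
      _ = 2 / R * ∫ y in (-R)..R, (massDens a b t y + gradDens a b t y) := by
          rw [← intervalIntegral.integral_const_mul]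
          congr 1; ext y; ring
      _ ≤ 2 / R * K := by
          gcongr
          exact intervalIntegral_le_of_le
            (((smooth₂_massDens h.smooth_a h.smooth_b).continuous_x t).add
              ((smooth₂_gradDens h.smooth_a h.smooth_b).continuous_x t)) (h.int_mass_grad ht)
            (fun x => add_nonneg (massDens_nonneg _ _ _ _) (gradDens_nonneg _ _ _ _))
            (fun x => le_rfl) hK hR
      _ = _ := by ring
  have b1 := abs_le.1 (bound x hx)
  have b2 := abs_le.1 (bound R ⟨hle, le_rfl⟩)
  have e : 12 * K / R = 6 * (2 * K / R) := by ring
  rw [prim x, prim R, cutoff_right hR, e, abs_le]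
  constructor <;> linarith [b1.1, b1.2, b2.1, b2.2]

lemma integral_abs_momDens_le (h : NLSPair T a b) {m G t : ℝ} (ht : t ∈ Set.Icc 0 T)
    (hm : ∫ x, massDens a b t x ≤ m) (hG : ∫ x, gradDens a b t x ≤ G) :
    Integrable (fun x => |momDens a b t x|) ∧ ∫ x, |momDens a b t x| ≤ √(m * G) := by
  have hi : Integrable fun x => |momDens a b t x| := by
    refine ((h.int_mass_grad ht).div_const 2).mono'
      ((smooth₂_momDens h.smooth_a h.smooth_b).continuous_x t).abs.aestronglyMeasurable
      (Filter.Eventually.of_forall fun x => ?_)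
    rw [Real.norm_eq_abs, abs_abs]
    exact abs_momDens_le_half a b t x
  refine ⟨hi, Real.le_sqrt_of_sq_le ?_⟩
  refine (integral_sq_le_of_sq_le_mul hi (h.int_mass ht) (h.int_grad ht) (massDens_nonneg a b t)
    (gradDens_nonneg a b t) fun x => ?_).trans ?_
  · rw [sq_abs]
    unfold momDens massDens gradDens
    nlinarith [sq_nonneg (a t x * pdx a t x + b t x * pdx b t x)]
  · exact mul_le_mul hm hG (integral_nonneg (gradDens_nonneg a b t))
      ((integral_nonneg (massDens_nonneg a b t)).trans hm)

/-- The localized interaction Morawetz estimate. -/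
lemma morawetz_cutoff (h : NLSPair T a b) (hT : 0 ≤ T) {m G : ℝ}
    (hm : ∀ t ∈ Set.Icc 0 T, ∫ x, massDens a b t x ≤ m)
    (hG : ∀ t ∈ Set.Icc 0 T, ∫ x, gradDens a b t x ≤ G) {R : ℝ} (hR : 1 ≤ R) :
    ∫ t in (0 : ℝ)..T, ∫ x in (-R)..R, cutoff R x ^ 2 * (2 * pdx (massDens a b) t x ^ 2)
      ≤ 2 * (m * √(m * G)) + (30 * (m + G) + 2 * (m + G) ^ 2) / R * (m + G) * T := by
  have ha := h.smooth_a
  have hb := h.smooth_b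
  have hρ := smooth₂_massDens ha hb
  have hp := smooth₂_momDens ha hb
  have hR0 : 0 < R := by linarith
  have hle : -R ≤ R := by linarith
  have hT0 : (0 : ℝ) ∈ Set.Icc 0 T := ⟨le_rfl, hT⟩
  have hm0 : 0 ≤ m := (integral_nonneg (massDens_nonneg a b 0)).trans (hm 0 hT0)
  have hG0 : 0 ≤ G := (integral_nonneg (gradDens_nonneg a b 0)).trans (hG 0 hT0)
  have hK : ∀ t ∈ Set.Icc 0 T, ∫ x, (massDens a b t x + gradDens a b t x) ≤ m + G := by
    intro t ht
    rw [integral_add (h.int_mass ht) (h.int_grad ht)]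
    exact add_le_add (hm t ht) (hG t ht)
  have hρr : ∀ t ∈ Set.Icc 0 T, ∀ r > 0, ∫ x in (-r)..r, massDens a b t x ≤ m :=
    fun t ht r hr => intervalIntegral_le_of_le (hρ.continuous_x t) (h.int_mass ht)
      (massDens_nonneg _ _ _) (fun x => le_rfl) (hm t ht) hr
  set Φ : ℝ → ℝ → ℝ := fun t x =>
    2 * cutoffPrim R (massDens a b) t x - cutoffPrim R (massDens a b) t R with hΦ
  set Φt : ℝ → ℝ → ℝ := fun t x =>
    2 * cutoffPrim R (pdt (massDens a b)) t x - cutoffPrim R (pdt (massDens a b)) t R with hΦt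
  have cPrim : ∀ {f : ℝ → ℝ → ℝ}, Smooth₂ f → Continuous (Function.uncurry fun t x =>
      2 * cutoffPrim R f t x - cutoffPrim R f t R) := by
    intro f hf
    have c := continuous_cutoffPrim (R := R) hf
    exact (continuous_const.mul c).sub
      (c.comp (f := fun z : ℝ × ℝ => (z.1, R)) (by fun_prop))
  have cΦ : Continuous (Function.uncurry Φ) := cPrim hρ
  have cΦt : Continuous (Function.uncurry Φt) := cPrim hρ.pdt
  have cΦ' : ∀ t, Continuous (Φ t) := fun t => cΦ.comp (by fun_prop : Continuous fun x => (t, x))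
  have cΦt' : ∀ t, Continuous (Φt t) := fun t =>
    cΦt.comp (by fun_prop : Continuous fun x => (t, x))
  have hΦb : ∀ t ∈ Set.Icc 0 T, ∀ x ∈ Set.Icc (-R) R, |Φ t x| ≤ m := fun t ht x hx =>
    abs_cutoffPrim_le hρ (massDens_nonneg a b) hR0 (hρr t ht) hx
  set M : ℝ → ℝ := fun t => ∫ x in (-R)..R, cutoff R x * (momDens a b t x * Φ t x) with hM
  set M' : ℝ → ℝ := fun t => ∫ x in (-R)..R,
    cutoff R x * (pdt (momDens a b) t x * Φ t x + momDens a b t x * Φt t x) with hM'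
  have cχ : Continuous (Function.uncurry fun (_ : ℝ) x => cutoff R x) :=
    (smooth₂_cutoff R).continuous
  have cG' : Continuous (Function.uncurry fun t x =>
      cutoff R x * (pdt (momDens a b) t x * Φ t x + momDens a b t x * Φt t x)) :=
    cχ.mul ((hp.pdt.continuous.mul cΦ).add (hp.continuous.mul cΦt))
  have hMd : ∀ t, HasDerivAt M (M' t) t := fun t =>
    hasDerivAt_intervalIntegral_of_continuous
      (G := fun t x => cutoff R x * (momDens a b t x * Φ t x))
      (G' := fun t x => cutoff R x * (pdt (momDens a b) t x * Φ t x + momDens a b t x * Φt t x))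
      (cχ.mul (hp.continuous.mul cΦ)) cG'
      (fun t x => ((hp.hasDerivAt_t t x).mul (((hasDerivAt_cutoffPrim_t hρ t x).const_mul 2).sub
        (hasDerivAt_cutoffPrim_t hρ t R))).const_mul _) t
  have cM' : Continuous M' :=
    intervalIntegral.continuous_parametric_intervalIntegral_of_continuous' cG' _ _
  have hMb : ∀ t ∈ Set.Icc 0 T, |M t| ≤ m * √(m * G) := by
    intro t ht
    obtain ⟨hi, hI⟩ := h.integral_abs_momDens_le ht (hm t ht) (hG t ht)
    have c1 : Continuous fun x => cutoff R x * (momDens a b t x * Φ t x) :=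
      (continuous_cutoff R).mul ((hp.continuous_x t).mul (cΦ' t))
    calc |M t| ≤ ∫ x in (-R)..R, |cutoff R x * (momDens a b t x * Φ t x)| :=
          intervalIntegral.abs_integral_le_integral_abs hle
      _ ≤ ∫ x in (-R)..R, m * |momDens a b t x| := by
          refine intervalIntegral.integral_mono_on hle (c1.abs.intervalIntegrable _ _)
            ((hi.const_mul m).intervalIntegrable) fun x hx => ?_
          rw [abs_mul, abs_mul, abs_of_nonneg (cutoff_nonneg R x)]
          calc cutoff R x * (|momDens a b t x| * |Φ t x|)
              ≤ 1 * (|momDens a b t x| * m) := by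
                gcongr
                · exact cutoff_le_one hR0 hx
                · exact hΦb t ht x hx
            _ = _ := by ring
      _ = m * ∫ x in (-R)..R, |momDens a b t x| := intervalIntegral.integral_const_mul _ _
      _ ≤ m * √(m * G) := by
          gcongr
          exact intervalIntegral_le_of_le (hp.continuous_x t).abs hi (fun x => abs_nonneg _)
            (fun x => le_rfl) hI hR0
  have hlow : ∀ t ∈ Set.Icc 0 T,
      (∫ x in (-R)..R, cutoff R x ^ 2 * (2 * pdx (massDens a b) t x ^ 2))
        - (30 * (m + G) + 2 * (m + G) ^ 2) / R * (m + G) ≤ M' t := by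
    intro t ht
    have hpd := pdx_massDens ha hb t
    have key := morawetz_slice (R := R) (K := m + G) hR (by positivity) (Φ := Φ t) (Φt := Φt t)
      (ρ := massDens a b t) (g := gradDens a b t) (p := momDens a b t)
      (pt := pdt (momDens a b) t) (q := fun x => a t x * pdx a t x + b t x * pdx b t x)
      (q' := fun x => pdx a t x ^ 2 + a t x * pdx (pdx a) t x
        + (pdx b t x ^ 2 + b t x * pdx (pdx b) t x))
      (fun x => ((hasDerivAt_cutoffPrim_x hρ t x).const_mul 2).sub_const _)
      (fun x => (hρ.hasDerivAt_x t x).congr_deriv (hpd x)) (fun x => ?_)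
      (h.hasDerivAt_momentum_flux ht) (hp.pdt.continuous_x t)
      ((smooth₂_gradDens ha hb).continuous_x t) ?_ (hp.continuous_x t) (cΦt' t)
      (fun x hx => (hΦb t ht x hx).trans (by linarith))
      (fun x hx => h.abs_weightDeriv_add_le hR0 ht (hK t ht) hx)
      (massDens_nonneg a b t) (fun x => (h.mass_le ht x).trans (hK t ht))
      (gradDens_nonneg a b t) (fun x => ?_) (abs_momDens_le a b t) (fun x => ?_)
      (intervalIntegral_le_of_le ((hρ.continuous_x t).add
        ((smooth₂_gradDens ha hb).continuous_x t)) (h.int_mass_grad ht)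
        (fun x => add_nonneg (massDens_nonneg _ _ _ _) (gradDens_nonneg _ _ _ _))
        (fun x => le_rfl) (hK t ht) hR0)
    · refine le_trans (le_of_eq ?_) key
      congr 2
      ext x
      rw [hpd x]
      ring
    · refine HasDerivAt.congr_deriv (((ha.hasDerivAt_x t x).fun_mul
        (ha.pdx.hasDerivAt_x t x)).fun_add ((hb.hasDerivAt_x t x).fun_mul
        (hb.pdx.hasDerivAt_x t x))) ?_
      ring
    · have c1 := ha.continuous_x t
      have c2 := hb.continuous_x t
      have c3 := ha.pdx.continuous_x t
      have c4 := hb.pdx.continuous_x t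
      have c5 := ha.pdx.pdx.continuous_x t
      have c6 := hb.pdx.pdx.continuous_x t
      fun_prop
    · unfold massDens gradDens momDens
      ring
    · rw [← hpd x]
      exact h.abs_pdx_mass_le t x
  have cY : Continuous fun t =>
      ∫ x in (-R)..R, cutoff R x ^ 2 * (2 * pdx (massDens a b) t x ^ 2) :=
    intervalIntegral.continuous_parametric_intervalIntegral_of_continuous'
      (((smooth₂_cutoff R).pow 2).mul ((smooth₂_const 2).mul (hρ.pdx.pow 2))).continuous _ _
  have hInt := intervalIntegral.integral_mono_on hT
    ((cY.fun_sub continuous_const).intervalIntegrable (μ := volume) 0 T)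
    (cM'.intervalIntegrable 0 T) hlow
  rw [intervalIntegral.integral_sub (cY.intervalIntegrable _ _)
    (continuous_const.intervalIntegrable _ _), intervalIntegral.integral_const,
    intervalIntegral.integral_eq_sub_of_hasDerivAt (fun t _ => hMd t)
      (cM'.intervalIntegrable _ _)] at hInt
  have h1 := abs_le.1 (hMb T ⟨hT, le_rfl⟩)
  have h2 := abs_le.1 (hMb 0 hT0)
  rw [sub_zero, smul_eq_mul] at hInt
  linarith [h1.2, h2.1]

/-- The interaction Morawetz estimate. -/
lemma morawetz (h : NLSPair T a b) (hT : 0 ≤ T) {m G : ℝ}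
    (hm : ∀ t ∈ Set.Icc 0 T, ∫ x, massDens a b t x ≤ m)
    (hG : ∀ t ∈ Set.Icc 0 T, ∫ x, gradDens a b t x ≤ G) {r : ℝ} (hr : 0 < r) :
    ∫ t in (0 : ℝ)..T, ∫ x in (-r)..r, pdx (massDens a b) t x ^ 2 ≤ m * √(m * G) := by
  have hρ := (smooth₂_massDens h.smooth_a h.smooth_b).pdx.pow 2
  set C := (30 * (m + G) + 2 * (m + G) ^ 2) * (m + G) * T with hC
  set I := ∫ t in (0 : ℝ)..T, ∫ x in (-r)..r, pdx (massDens a b) t x ^ 2 with hI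
  have key : ∀ R ≥ max r 1, 2 * ((1 - (r / R) ^ 2) ^ 2) ^ 2 * I
      ≤ 2 * (m * √(m * G)) + C / R := by
    intro R hR
    have hrR : r ≤ R := (le_max_left _ _).trans hR
    have hR0 : 0 < R := hr.trans_le hrR
    refine le_trans ?_ ((h.morawetz_cutoff hT hm hG ((le_max_right _ _).trans hR)).trans
      (le_of_eq (by rw [hC]; ring)))
    have hχ : ∀ x ∈ Set.Icc (-r) r, (1 - (r / R) ^ 2) ^ 2 ≤ cutoff R x := by
      intro x hx
      have h1 : (x / R) ^ 2 ≤ (r / R) ^ 2 := by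
        rw [div_pow, div_pow]
        exact div_le_div_of_nonneg_right (sq_le_sq' hx.1 hx.2) (by positivity)
      have h2 : (r / R) ^ 2 ≤ 1 :=
        pow_le_one₀ (by positivity) ((div_le_one hR0).2 hrR)
      exact pow_le_pow_left₀ (by linarith) (by linarith) 2
    rw [hI, ← intervalIntegral.integral_const_mul]
    have c1 : Continuous fun t => ∫ x in (-r)..r, pdx (massDens a b) t x ^ 2 :=
      intervalIntegral.continuous_parametric_intervalIntegral_of_continuous' hρ.continuous _ _
    have c2 : Continuous fun t =>
        ∫ x in (-R)..R, cutoff R x ^ 2 * (2 * pdx (massDens a b) t x ^ 2) :=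
      intervalIntegral.continuous_parametric_intervalIntegral_of_continuous'
        (((smooth₂_cutoff R).pow 2).mul ((smooth₂_const 2).mul hρ)).continuous _ _
    refine intervalIntegral.integral_mono_on hT ((c1.const_mul _).intervalIntegrable _ _)
      (c2.intervalIntegrable _ _) fun t ht => ?_
    have c3 := hρ.continuous_x t
    have c4 : Continuous fun x => cutoff R x ^ 2 * (2 * pdx (massDens a b) t x ^ 2) :=
      ((continuous_cutoff R).pow 2).mul (c3.const_mul 2)
    rw [← intervalIntegral.integral_const_mul]
    calc _ ≤ ∫ x in (-r)..r, cutoff R x ^ 2 * (2 * pdx (massDens a b) t x ^ 2) := by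
          refine intervalIntegral.integral_mono_on (by linarith)
            ((c3.const_mul _).intervalIntegrable _ _) (c4.intervalIntegrable _ _) fun x hx => ?_
          have h1 := hχ x hx
          have : ((1 - (r / R) ^ 2) ^ 2) ^ 2 ≤ cutoff R x ^ 2 := by gcongr
          nlinarith [sq_nonneg (pdx (massDens a b) t x)]
      _ ≤ _ := intervalIntegral.integral_mono_interval (by linarith) (by linarith) hrR
          (Filter.Eventually.of_forall fun x => by
            have := cutoff_nonneg R x
            show 0 ≤ cutoff R x ^ 2 * (2 * pdx (massDens a b) t x ^ 2)
            positivity) (c4.intervalIntegrable _ _)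
  have hlim : Filter.Tendsto (fun R : ℝ => 2 * ((1 - (r / R) ^ 2) ^ 2) ^ 2 * I) Filter.atTop
      (nhds (2 * ((1 - 0 ^ 2) ^ 2) ^ 2 * I)) :=
    ((((((tendsto_const_nhds.div_atTop Filter.tendsto_id).pow 2).const_sub 1).pow 2).pow
      2).const_mul 2).mul_const I
  have hlim2 : Filter.Tendsto (fun R : ℝ => 2 * (m * √(m * G)) + C / R) Filter.atTop
      (nhds (2 * (m * √(m * G)) + 0)) :=
    (tendsto_const_nhds.div_atTop Filter.tendsto_id).const_add _
  have := le_of_tendsto_of_tendsto hlim hlim2 ((Filter.eventually_ge_atTop (max r 1)).mono key)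
  linarith

end NLSPair

/-- A form of Fatou's lemma for Bochner integrals. -/
lemma setIntegral_le_of_tendsto {s : Set ℝ} (hs : MeasurableSet s) {f g : ℝ → ℝ}
    {F : ℕ → ℝ → ℝ} {B : ℝ} (hB : 0 ≤ B) (hf0 : ∀ t ∈ s, 0 ≤ f t) (hfg : ∀ t ∈ s, f t ≤ g t)
    (hF : ∀ n, IntegrableOn (F n) s) (hF0 : ∀ n, ∀ t ∈ s, 0 ≤ F n t)
    (hlim : ∀ t ∈ s, Filter.Tendsto (fun n => F n t) Filter.atTop (nhds (g t)))
    (hFB : ∀ n, ∫ t in s, F n t ≤ B) : ∫ t in s, f t ≤ B := by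
  by_cases hf : IntegrableOn f s
  swap
  · rw [integral_undef hf]
    exact hB
  rw [← ENNReal.ofReal_le_ofReal_iff hB,
    ofReal_integral_eq_lintegral_ofReal hf (ae_restrict_of_forall_mem hs hf0)]
  calc ∫⁻ t in s, ENNReal.ofReal (f t)
      ≤ ∫⁻ t in s, Filter.liminf (fun n => ENNReal.ofReal (F n t)) Filter.atTop := by
        refine lintegral_mono_ae (ae_restrict_of_forall_mem hs fun t ht => ?_)
        have hl := ((ENNReal.continuous_ofReal.tendsto _).comp (hlim t ht)).liminf_eq
        rw [Function.comp_def] at hl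
        rw [hl]
        exact ENNReal.ofReal_le_ofReal (hfg t ht)
    _ ≤ Filter.liminf (fun n => ∫⁻ t in s, ENNReal.ofReal (F n t)) Filter.atTop :=
        lintegral_liminf_le' fun n => (hF n).aestronglyMeasurable.aemeasurable.ennreal_ofReal
    _ ≤ ENNReal.ofReal B := by
        refine Filter.liminf_le_of_frequently_le' (Filter.Frequently.of_forall fun n => ?_)
        rw [← ofReal_integral_eq_lintegral_ofReal (hF n) (ae_restrict_of_forall_mem hs (hF0 n))]
        exact ENNReal.ofReal_le_ofReal (hFB n)

namespace NLSPair

variable {T : ℝ} {a b : ℝ → ℝ → ℝ}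

lemma pdx_mass_sq_le (h : NLSPair T a b) (t x : ℝ) :
    pdx (massDens a b) t x ^ 2 ≤ 4 * massDens a b t x * gradDens a b t x := by
  rw [pdx_massDens h.smooth_a h.smooth_b]
  unfold massDens gradDens
  nlinarith [sq_nonneg (a t x * pdx b t x - b t x * pdx a t x)]

lemma int_pdx_mass_sq (h : NLSPair T a b) {t : ℝ} (ht : t ∈ Set.Icc 0 T) :
    Integrable fun x => pdx (massDens a b) t x ^ 2 := by
  refine ((h.int_grad ht).const_mul
    (4 * ∫ y, (massDens a b t y + gradDens a b t y))).mono'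
    (((smooth₂_massDens h.smooth_a h.smooth_b).pdx.continuous_x t).pow 2).aestronglyMeasurable
    (Filter.Eventually.of_forall fun x => ?_)
  rw [Real.norm_of_nonneg (sq_nonneg _)]
  exact (h.pdx_mass_sq_le t x).trans (mul_le_mul_of_nonneg_right
    (mul_le_mul_of_nonneg_left (h.mass_le ht x) (by norm_num)) (gradDens_nonneg _ _ _ _))

/-- A Gagliardo–Nirenberg inequality for the mass density. -/
lemma integral_mass_cube_le (h : NLSPair T a b) {t : ℝ} (ht : t ∈ Set.Icc 0 T) {μ : ℝ}
    (hμ : 0 < μ) : ∫ x, massDens a b t x ^ 3 ≤ (∫ x, massDens a b t x)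
      * (μ ^ 2 + 4 * (∫ x, massDens a b t x) * (∫ x, pdx (massDens a b) t x ^ 2) / μ) := by
  have hs := smooth₂_massDens h.smooth_a h.smooth_b
  have hρ0 : ∀ x, 0 ≤ massDens a b t x := massDens_nonneg a b t
  have hi1 := h.int_mass ht
  have hi2 := h.int_mass_sq ht
  have hiD := h.int_pdx_mass_sq ht
  set ρ := massDens a b t with hρ
  set m := ∫ x, ρ x with hm
  set D := ∫ x, pdx (massDens a b) t x ^ 2 with hD
  have hm0 : 0 ≤ m := integral_nonneg hρ0
  have hD0 : 0 ≤ D := integral_nonneg fun x => sq_nonneg _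
  have hif : Integrable fun x => ρ x * |pdx (massDens a b) t x| := by
    refine (hi2.add hiD).mono' ((hs.continuous_x t).mul
      (hs.pdx.continuous_x t).abs).aestronglyMeasurable (Filter.Eventually.of_forall fun x => ?_)
    rw [Real.norm_of_nonneg (mul_nonneg (hρ0 x) (abs_nonneg _)), Pi.add_apply]
    nlinarith [sq_nonneg (ρ x - |pdx (massDens a b) t x|), sq_abs (pdx (massDens a b) t x)]
  have hcs := integral_sq_le_of_sq_le_mul hif hi2 hiD (fun x => sq_nonneg _)
    (fun x => sq_nonneg _) (fun x => by rw [mul_pow, sq_abs])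
  set A := ∫ x, ρ x ^ 2 with hA
  set I := ∫ x, ρ x * |pdx (massDens a b) t x| with hI
  have hA0 : 0 ≤ A := integral_nonneg fun x => sq_nonneg _
  have hI0 : 0 ≤ I := integral_nonneg fun x => mul_nonneg (hρ0 x) (abs_nonneg _)
  have hsq : ∀ x, ρ x ^ 2 ≤ 2 * I := by
    intro x
    have hd : ∀ y, HasDerivAt (fun y => ρ y ^ 2) (2 * (ρ y * pdx (massDens a b) t y)) y :=
      fun y => ((hs.hasDerivAt_x t y).fun_pow 2).congr_deriv (by simp [hρ]; ring)
    have hi' : Integrable fun y => 2 * (ρ y * pdx (massDens a b) t y) := by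
      refine (hif.const_mul 2).mono' (continuous_const.mul ((hs.continuous_x t).mul
        (hs.pdx.continuous_x t))).aestronglyMeasurable (Filter.Eventually.of_forall fun x => ?_)
      rw [Real.norm_eq_abs, abs_mul, abs_mul, abs_two, abs_of_nonneg (hρ0 x)]
    have e := integral_Iic_of_hasDerivAt_of_tendsto' (a := x) (fun y _ => hd y)
      hi'.integrableOn ((h.tendsto_mass ht).pow 2)
    rw [zero_pow two_ne_zero, sub_zero] at e
    rw [← e, hI, ← integral_const_mul]
    calc _ ≤ ∫ y in Set.Iic x, 2 * (ρ y * |pdx (massDens a b) t y|) :=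
          setIntegral_mono hi'.integrableOn (hif.const_mul 2).integrableOn fun y =>
            mul_le_mul_of_nonneg_left (mul_le_mul_of_nonneg_left (le_abs_self _) (hρ0 y))
              (by norm_num)
      _ ≤ _ := setIntegral_le_integral (hif.const_mul 2) (Filter.Eventually.of_forall fun y =>
          mul_nonneg (by norm_num) (mul_nonneg (hρ0 y) (abs_nonneg _)))
  set w := √(2 * I) with hw
  have hw0 : 0 ≤ w := Real.sqrt_nonneg _
  have hw2 : w ^ 2 = 2 * I := Real.sq_sqrt (by positivity)
  have hρw : ∀ x, ρ x ≤ w := fun x => Real.le_sqrt_of_sq_le (hsq x)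
  have hAw : A ≤ w * m := by
    rw [hA, hm, ← integral_const_mul]
    refine integral_mono hi2 (hi1.const_mul w) fun x => ?_
    show ρ x ^ 2 ≤ w * ρ x
    rw [sq]
    exact mul_le_mul_of_nonneg_right (hρw x) (hρ0 x)
  have hw4 : w * w ^ 3 ≤ w * (4 * m * D) := by
    have h1 : A * D ≤ w * m * D := mul_le_mul_of_nonneg_right hAw hD0
    calc w * w ^ 3 = 4 * I ^ 2 := by rw [show w * w ^ 3 = (w ^ 2) ^ 2 by ring, hw2]; ring
      _ ≤ w * (4 * m * D) := by linarith
  have hw3 : w ^ 3 ≤ 4 * m * D := by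
    rcases hw0.eq_or_lt with h0 | h0
    · rw [← h0]
      simp only [ne_eq, OfNat.ofNat_ne_zero, not_false_eq_true, zero_pow]
      positivity
    · exact le_of_mul_le_mul_left hw4 h0
  have hww : w ^ 2 ≤ μ ^ 2 + 4 * m * D / μ := by
    rcases le_total w μ with h1 | h1
    · have : 0 ≤ 4 * m * D / μ := by positivity
      nlinarith
    · have : w ^ 2 ≤ 4 * m * D / μ := by
        rw [le_div_iff₀ hμ]
        nlinarith [sq_nonneg w]
      nlinarith [sq_nonneg μ]
  calc ∫ x, ρ x ^ 3 ≤ ∫ x, w ^ 2 * ρ x := by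
        refine integral_mono_of_nonneg (Filter.Eventually.of_forall fun x => pow_nonneg (hρ0 x) 3)
          (hi1.const_mul _) (Filter.Eventually.of_forall fun x => ?_)
        show ρ x ^ 3 ≤ w ^ 2 * ρ x
        rw [pow_succ]
        exact mul_le_mul_of_nonneg_right (pow_le_pow_left₀ (hρ0 x) (hρw x) 2) (hρ0 x)
    _ = w ^ 2 * m := integral_const_mul _ _
    _ ≤ _ := by
        rw [mul_comm]
        exact mul_le_mul_of_nonneg_left hww hm0

/-- The space-time `L⁶` bound, with a free parameter `μ`. -/
lemma integral_integral_mass_cube_le (h : NLSPair T a b) (hT : 0 ≤ T) {m G : ℝ}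
    (hm : ∀ t ∈ Set.Icc 0 T, ∫ x, massDens a b t x ≤ m)
    (hG : ∀ t ∈ Set.Icc 0 T, ∫ x, gradDens a b t x ≤ G) {μ : ℝ} (hμ : 0 < μ) :
    ∫ t in Set.Ioc 0 T, ∫ x, massDens a b t x ^ 3
      ≤ m * (T * μ ^ 2 + 4 * m / μ * (m * √(m * G))) := by
  have hm0 : 0 ≤ m := (integral_nonneg (massDens_nonneg a b 0)).trans (hm 0 ⟨le_rfl, hT⟩)
  have hρ := (smooth₂_massDens h.smooth_a h.smooth_b).pdx.pow 2
  have cD : ∀ n : ℕ, Continuous fun t => m * (μ ^ 2 + 4 * m / μ *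
      ∫ x in (-(n : ℝ))..n, pdx (massDens a b) t x ^ 2) := fun n =>
    continuous_const.mul (continuous_const.add (continuous_const.mul
      (intervalIntegral.continuous_parametric_intervalIntegral_of_continuous'
        hρ.continuous _ _)))
  have hD0 : ∀ (n : ℕ) (t : ℝ), 0 ≤ ∫ x in (-(n : ℝ))..n, pdx (massDens a b) t x ^ 2 :=
    fun n t => intervalIntegral.integral_nonneg (by linarith [n.cast_nonneg (α := ℝ)])
      fun x _ => sq_nonneg _
  refine setIntegral_le_of_tendsto measurableSet_Ioc (g := fun t => m * (μ ^ 2 + 4 * m / μ *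
      ∫ x, pdx (massDens a b) t x ^ 2)) (F := fun n t => m * (μ ^ 2 + 4 * m / μ *
      ∫ x in (-(n : ℝ))..n, pdx (massDens a b) t x ^ 2)) (by positivity)
    (fun t _ => integral_nonneg fun x => pow_nonneg (massDens_nonneg _ _ _ _) 3)
    (fun t ht => ?_) (fun n => (cD n).integrableOn_Ioc)
    (fun n t _ => mul_nonneg hm0 (add_nonneg (sq_nonneg _)
      (mul_nonneg (by positivity) (hD0 n t)))) (fun t ht => ?_) (fun n => ?_)
  · have ht' : t ∈ Set.Icc 0 T := ⟨ht.1.le, ht.2⟩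
    have h0 : 0 ≤ ∫ x, massDens a b t x := integral_nonneg (massDens_nonneg a b t)
    have hD : 0 ≤ ∫ x, pdx (massDens a b) t x ^ 2 := integral_nonneg fun x => sq_nonneg _
    have hmt := hm t ht'
    refine (h.integral_mass_cube_le ht' hμ).trans ?_
    rw [div_mul_eq_mul_div]
    gcongr
  · exact ((intervalIntegral_tendsto_integral (h.int_pdx_mass_sq ⟨ht.1.le, ht.2⟩)
      (Filter.tendsto_neg_atTop_atBot.comp tendsto_natCast_atTop_atTop)
      tendsto_natCast_atTop_atTop).const_mul _).const_add _ |>.const_mul _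
  · rw [← intervalIntegral.integral_of_le hT, intervalIntegral.integral_const_mul,
      intervalIntegral.integral_add (continuous_const.intervalIntegrable _ _) ?_,
      intervalIntegral.integral_const, intervalIntegral.integral_const_mul, sub_zero, smul_eq_mul]
    · have h1 : ∫ t in (0 : ℝ)..T, ∫ x in (-(n : ℝ))..n, pdx (massDens a b) t x ^ 2
          ≤ m * √(m * G) := by
        rcases n.eq_zero_or_pos with rfl | hn
        · simp only [Nat.cast_zero, neg_zero, intervalIntegral.integral_same,
            intervalIntegral.integral_zero]
          positivity
        · exact h.morawetz hT hm hG (by exact_mod_cast hn)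
      gcongr
    · exact (continuous_const.mul
        (intervalIntegral.continuous_parametric_intervalIntegral_of_continuous'
          hρ.continuous _ _)).intervalIntegrable _ _

/-- The space-time `L⁶` bound for a solution whose squared `L²` norm is `L ^ 2`. -/
lemma integral_integral_mass_cube_le_rpow (h : NLSPair T a b) (hT : 0 < T) {L G : ℝ} (hL : 0 ≤ L)
    (hm : ∀ t ∈ Set.Icc 0 T, ∫ x, massDens a b t x ≤ L ^ 2)
    (hG : ∀ t ∈ Set.Icc 0 T, ∫ x, gradDens a b t x ≤ G ^ 2) (hG0 : 0 ≤ G) :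
    ∫ t in Set.Ioc 0 T, ∫ x, massDens a b t x ^ 3
      ≤ T ^ ((1 : ℝ) / 3) * (L ^ 6 + 4 * (L ^ 5 * G)) := by
  set τ := T ^ ((1 : ℝ) / 3) with hτ
  have hτ0 : 0 < τ := Real.rpow_pos_of_pos hT _
  have hτ3 : τ ^ 3 = T := by
    rw [hτ, ← Real.rpow_natCast, ← Real.rpow_mul hT.le]
    norm_num
  rcases hL.eq_or_lt with h0 | h0
  · subst h0
    have := h.integral_integral_mass_cube_le hT.le hm hG one_pos
    simpa using this
  · have := h.integral_integral_mass_cube_le hT.le hm hG (μ := L ^ 2 / τ) (by positivity)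
    refine this.trans (le_of_eq ?_)
    rw [show √(L ^ 2 * G ^ 2) = L * G by rw [← mul_pow]; exact Real.sqrt_sq (by positivity),
      ← hτ3]
    field_simp

end NLSPair

open scoped LineDeriv

/-- The isometry of `ℝ` with the one-dimensional Euclidean space. -/
def realIso : ℝ ≃ₗᵢ[ℝ] EuclideanSpace ℝ (Fin 1) := (OrthonormalBasis.singleton (Fin 1) ℝ).repr

lemma realIso_one : realIso 1 = EuclideanSpace.single 0 1 := by
  have := (OrthonormalBasis.singleton (Fin 1) ℝ).repr_self 0
  rwa [OrthonormalBasis.singleton_apply] at this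

lemma integral_comp_realIso (f : EuclideanSpace ℝ (Fin 1) → ℝ) :
    ∫ x, f (realIso x) = ∫ y, f y :=
  realIso.measurePreserving.integral_comp realIso.toHomeomorph.measurableEmbedding f

lemma IsSchwartz.pd_zero {f : EuclideanSpace ℝ (Fin 1) → ℂ} (hf : IsSchwartz f) :
    IsSchwartz (pd 0 f) := by
  obtain ⟨g, rfl⟩ := hf
  refine ⟨∂_{EuclideanSpace.single (0 : Fin 1) (1 : ℝ)} g, ?_⟩
  ext x
  exact SchwartzMap.lineDerivOp_apply_eq_fderiv _ _ _

lemma hasDerivAt_comp_realIso {f : EuclideanSpace ℝ (Fin 1) → ℂ}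
    (hf : Differentiable ℝ f) (x : ℝ) :
    HasDerivAt (fun y => f (realIso y)) (pd 0 f (realIso x)) x := by
  have h1 := (hf (realIso x)).hasFDerivAt.comp_hasDerivAt x
    realIso.toContinuousLinearEquiv.toContinuousLinearMap.hasDerivAt
  refine h1.congr_deriv ?_
  show fderiv ℝ f (realIso x) (realIso 1) = _
  rw [realIso_one]
  rfl

lemma IsSchwartz.integrable_norm_sq {f : EuclideanSpace ℝ (Fin 1) → ℂ} (hf : IsSchwartz f) :
    Integrable fun x : ℝ => ‖f (realIso x)‖ ^ 2 := by
  obtain ⟨g, rfl⟩ := hf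
  have h : Integrable fun y => ‖g y‖ ^ 2 := (g.memLp 2).integrable_norm_pow two_ne_zero
  exact (realIso.measurePreserving.integrable_comp_emb
    realIso.toHomeomorph.measurableEmbedding).2 h

lemma IsSchwartz.tendsto_atBot {f : EuclideanSpace ℝ (Fin 1) → ℂ} (hf : IsSchwartz f) :
    Filter.Tendsto (fun x : ℝ => f (realIso x)) Filter.atBot (nhds 0) := by
  obtain ⟨g, rfl⟩ := hf
  refine (zero_at_infty g).comp
    (realIso.toHomeomorph.isClosedEmbedding.tendsto_cocompact.mono_left ?_)
  rw [cocompact_eq_atBot_atTop]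
  exact le_sup_left

/-- Plancherel's identity for the derivative of a Schwartz function. -/
lemma IsSchwartz.integral_norm_sq_pd {f : EuclideanSpace ℝ (Fin 1) → ℂ} (hf : IsSchwartz f) :
    ∫ x, ‖pd 0 f x‖ ^ 2 = (2 * π * HdotNorm 1 f) ^ 2 := by
  obtain ⟨g, rfl⟩ := hf
  set e : EuclideanSpace ℝ (Fin 1) := EuclideanSpace.single 0 1
  have h1 : ∀ x, pd 0 (⇑g) x = (∂_{e} g) x := fun x =>
    (SchwartzMap.lineDerivOp_apply_eq_fderiv _ _ _).symm
  have h3 : (inner ℝ · e : EuclideanSpace ℝ (Fin 1) → ℝ).HasTemperateGrowth :=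
    ((innerSL ℝ).flip e).hasTemperateGrowth
  have h2 : ∀ ξ : EuclideanSpace ℝ (Fin 1), ‖𝓕 (∂_{e} g) ξ‖ ^ 2
      = (2 * π) ^ 2 * (‖ξ‖ ^ (2 * (1 : ℝ)) * ‖𝓕 (⇑g) ξ‖ ^ 2) := by
    intro ξ
    have hn : ‖ξ‖ ^ 2 = (ξ 0) ^ 2 := by
      rw [EuclideanSpace.norm_sq_eq]
      simp
    rw [SchwartzMap.fourier_lineDerivOp_eq, smul_apply,
      SchwartzMap.smulLeftCLM_apply_apply h3, mul_one, Real.rpow_two, hn,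
      EuclideanSpace.inner_single_right]
    simp only [norm_smul, norm_mul, SchwartzMap.fourier_coe]
    simp [mul_pow, sq_abs]
  simp_rw [h1]
  rw [← SchwartzMap.integral_norm_sq_fourier]
  simp_rw [h2]
  rw [integral_const_mul, mul_pow _ (HdotNorm 1 (⇑g)), HdotNorm, ← Real.sqrt_eq_rpow,
    Real.sq_sqrt (integral_nonneg fun ξ => by positivity)]

lemma L2Norm_sq (f : EuclideanSpace ℝ (Fin 1) → ℂ) : L2Norm f ^ 2 = ∫ x, ‖f x‖ ^ 2 := by
  rw [L2Norm, ← Real.sqrt_eq_rpow, Real.sq_sqrt]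
  exact integral_nonneg fun x => by positivity

lemma L2Norm_nonneg (f : EuclideanSpace ℝ (Fin 1) → ℂ) : 0 ≤ L2Norm f :=
  Real.rpow_nonneg (integral_nonneg fun x => by positivity) _

lemma HdotNorm_nonneg (σ : ℝ) (f : EuclideanSpace ℝ (Fin 1) → ℂ) : 0 ≤ HdotNorm σ f :=
  Real.rpow_nonneg (integral_nonneg fun x => by positivity) _

lemma contDiff_pd {f : EuclideanSpace ℝ (Fin 1) → ℂ} (hf : ContDiff ℝ ∞ f) :
    ContDiff ℝ ∞ (pd 0 f) := by
  unfold pd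
  exact (hf.fderiv_right (m := ∞) (by simp)).clm_apply contDiff_const

/-- The real part of a function on `ℝ × ℝ¹`, as a function of two real variables. -/
def rePart (u : ℝ → EuclideanSpace ℝ (Fin 1) → ℂ) (t x : ℝ) : ℝ := (u t (realIso x)).re

/-- The imaginary part of a function on `ℝ × ℝ¹`, as a function of two real variables. -/
def imPart (u : ℝ → EuclideanSpace ℝ (Fin 1) → ℂ) (t x : ℝ) : ℝ := (u t (realIso x)).im

lemma HasDerivAt.re_comp {f : ℝ → ℂ} {f' : ℂ} {x : ℝ} (h : HasDerivAt f f' x) :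
    HasDerivAt (fun y => (f y).re) f'.re x :=
  Complex.reCLM.hasFDerivAt.comp_hasDerivAt x h

lemma HasDerivAt.im_comp {f : ℝ → ℂ} {f' : ℂ} {x : ℝ} (h : HasDerivAt f f' x) :
    HasDerivAt (fun y => (f y).im) f'.im x :=
  Complex.imCLM.hasFDerivAt.comp_hasDerivAt x h

section parts

variable {u : ℝ → EuclideanSpace ℝ (Fin 1) → ℂ}

lemma smooth₂_rePart (hu : ContDiff ℝ ∞ (Function.uncurry u)) : Smooth₂ (rePart u) :=
  Complex.reCLM.contDiff.comp (hu.comp (contDiff_fst.prodMk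
    (realIso.contDiff.comp contDiff_snd)))

lemma smooth₂_imPart (hu : ContDiff ℝ ∞ (Function.uncurry u)) : Smooth₂ (imPart u) :=
  Complex.imCLM.contDiff.comp (hu.comp (contDiff_fst.prodMk
    (realIso.contDiff.comp contDiff_snd)))

lemma contDiff_slice (hu : ContDiff ℝ ∞ (Function.uncurry u)) (t : ℝ) : ContDiff ℝ ∞ (u t) :=
  hu.comp (contDiff_const.prodMk contDiff_id)

lemma pdx_rePart (hu : ∀ t, ContDiff ℝ ∞ (u t)) :
    pdx (rePart u) = rePart fun t => pd 0 (u t) := by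
  ext t x
  exact (hasDerivAt_comp_realIso ((hu t).differentiable (by simp)) x).re_comp.deriv

lemma pdx_imPart (hu : ∀ t, ContDiff ℝ ∞ (u t)) :
    pdx (imPart u) = imPart fun t => pd 0 (u t) := by
  ext t x
  exact (hasDerivAt_comp_realIso ((hu t).differentiable (by simp)) x).im_comp.deriv

lemma rePart_sq_add_imPart_sq (t x : ℝ) :
    rePart u t x ^ 2 + imPart u t x ^ 2 = ‖u t (realIso x)‖ ^ 2 := by
  rw [Complex.sq_norm, Complex.normSq_apply, rePart, imPart]
  ring

lemma IsSchwartz.integrable_rePart_sq {t : ℝ} (h : IsSchwartz (u t)) :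
    Integrable fun x => rePart u t x ^ 2 := by
  refine h.integrable_norm_sq.mono' ?_ (Filter.Eventually.of_forall fun x => ?_)
  · obtain ⟨g, hg⟩ := h
    unfold rePart
    rw [← hg]
    exact ((Complex.continuous_re.comp (g.continuous.comp realIso.continuous)).pow
      2).aestronglyMeasurable
  · rw [Real.norm_of_nonneg (sq_nonneg _), ← rePart_sq_add_imPart_sq]
    exact le_add_of_nonneg_right (sq_nonneg _)

lemma IsSchwartz.integrable_imPart_sq {t : ℝ} (h : IsSchwartz (u t)) :
    Integrable fun x => imPart u t x ^ 2 := by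
  refine (h.integrable_norm_sq.sub h.integrable_rePart_sq).congr
    (Filter.Eventually.of_forall fun x => ?_)
  show ‖u t (realIso x)‖ ^ 2 - rePart u t x ^ 2 = _
  rw [← rePart_sq_add_imPart_sq]
  ring

lemma IsNLSSolution.nlsPair {T : ℝ} (h : IsNLSSolution 1 T u) :
    NLSPair T (rePart u) (imPart u) := by
  obtain ⟨hu, hS, heq⟩ := h
  have hs := contDiff_slice hu
  have hs' := fun t => contDiff_pd (hs t)
  have hd : ∀ t x, HasDerivAt (fun s => u s (realIso x))
      (deriv (fun s => u s (realIso x)) t) t := fun t x =>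
    (((hu.comp (contDiff_id.prodMk contDiff_const)).differentiable
      (by simp)).differentiableAt).hasDerivAt
  have hre : ∀ t x, pdt (rePart u) t x = (deriv (fun s => u s (realIso x)) t).re :=
    fun t x => (hd t x).re_comp.deriv
  have him : ∀ t x, pdt (imPart u) t x = (deriv (fun s => u s (realIso x)) t).im :=
    fun t x => (hd t x).im_comp.deriv
  have hlap : ∀ t x, lap (u t) x = pd 0 (pd 0 (u t)) x := fun t x => by simp [lap]
  have h2re : pdx (pdx (rePart u)) = rePart fun t => pd 0 (pd 0 (u t)) := by
    rw [pdx_rePart hs, pdx_rePart hs']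
  have h2im : pdx (pdx (imPart u)) = imPart fun t => pd 0 (pd 0 (u t)) := by
    rw [pdx_imPart hs, pdx_imPart hs']
  refine ⟨smooth₂_rePart hu, smooth₂_imPart hu, fun t ht x => ?_, fun t ht x => ?_,
    fun t ht => (hS t ht).integrable_rePart_sq, fun t ht => (hS t ht).integrable_imPart_sq,
    fun t ht => ?_, fun t ht => ?_, fun t ht => ?_, fun t ht => ?_, fun t ht => ?_,
    fun t ht => ?_⟩
  · have := (Complex.ext_iff.1 (heq t ht (realIso x))).2
    rw [hlap, ← Complex.ofReal_pow, ← rePart_sq_add_imPart_sq] at this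
    simp only [Complex.add_im, Complex.I_mul_im, Complex.im_ofReal_mul] at this
    rw [hre, h2im]
    unfold imPart at this ⊢
    linarith
  · have := (Complex.ext_iff.1 (heq t ht (realIso x))).1
    rw [hlap, ← Complex.ofReal_pow, ← rePart_sq_add_imPart_sq] at this
    simp only [Complex.add_re, Complex.I_mul_re, Complex.re_ofReal_mul] at this
    rw [him, h2re]
    unfold rePart at this ⊢
    linarith
  · rw [pdx_rePart hs]
    exact (hS t ht).pd_zero.integrable_rePart_sq (u := fun t => pd 0 (u t))
  · rw [pdx_imPart hs]
    exact (hS t ht).pd_zero.integrable_imPart_sq (u := fun t => pd 0 (u t))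
  · rw [h2re]
    exact (hS t ht).pd_zero.pd_zero.integrable_rePart_sq (u := fun t => pd 0 (pd 0 (u t)))
  · rw [h2im]
    exact (hS t ht).pd_zero.pd_zero.integrable_imPart_sq (u := fun t => pd 0 (pd 0 (u t)))
  · exact (Complex.continuous_re.tendsto 0).comp (hS t ht).tendsto_atBot
  · exact (Complex.continuous_im.tendsto 0).comp (hS t ht).tendsto_atBot

lemma massDens_parts (t x : ℝ) :
    massDens (rePart u) (imPart u) t x = ‖u t (realIso x)‖ ^ 2 := rePart_sq_add_imPart_sq t x

lemma integral_massDens_parts (t : ℝ) :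
    ∫ x, massDens (rePart u) (imPart u) t x = L2Norm (u t) ^ 2 := by
  simp_rw [massDens_parts]
  rw [L2Norm_sq]
  exact integral_comp_realIso fun y => ‖u t y‖ ^ 2

lemma integral_massDens_cube_parts (t : ℝ) :
    ∫ x, massDens (rePart u) (imPart u) t x ^ 3 = ∫ x, ‖u t x‖ ^ 6 := by
  simp_rw [massDens_parts, ← pow_mul]
  exact integral_comp_realIso fun y => ‖u t y‖ ^ 6

lemma IsSchwartz.integral_gradDens_parts (hu : ∀ t, ContDiff ℝ ∞ (u t)) {t : ℝ}
    (h : IsSchwartz (u t)) :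
    ∫ x, gradDens (rePart u) (imPart u) t x = (2 * π * HdotNorm 1 (u t)) ^ 2 := by
  simp_rw [gradDens, pdx_rePart hu, pdx_imPart hu, rePart_sq_add_imPart_sq]
  rw [← h.integral_norm_sq_pd]
  exact integral_comp_realIso fun y => ‖pd 0 (u t) y‖ ^ 2

end parts

/-- Lower bound of a real supremum over a set by the values of a nonnegative bounded function. -/
lemma le_biSup_of_nonneg {s : Set ℝ} {f : ℝ → ℝ} {B : ℝ} (hf : ∀ t ∈ s, 0 ≤ f t)
    (hB : ∀ t ∈ s, f t ≤ B) {t : ℝ} (ht : t ∈ s) : f t ≤ ⨆ t ∈ s, f t := by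
  have h0 : 0 ≤ B := (hf t ht).trans (hB t ht)
  have hb : BddAbove (Set.range fun t => ⨆ _ : t ∈ s, f t) := by
    refine ⟨B, ?_⟩
    rintro _ ⟨r, rfl⟩
    exact Real.iSup_le (fun hr => hB r hr) h0
  refine le_trans (le_of_eq ?_) (le_ciSup hb t)
  simp [ht]


/-- The a priori `L⁶_{t,x}` estimate for the cubic defocusing NLS in one
space dimension. -/
theorem interaction_morawetz_1d :
    ∃ C > (0:ℝ), ∀ T > (0:ℝ), ∀ u : ℝ → EuclideanSpace ℝ (Fin 1) → ℂ,
      IsNLSSolution 1 T u →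
      (∫ t in Set.Ioc (0:ℝ) T, ∫ x, ‖u t x‖ ^ 6)
        ≤ C * T ^ ((1:ℝ)/3) *
          ((⨆ t ∈ Set.Icc (0:ℝ) T, (L2Norm (u t)) ^ 5 * HdotNorm 1 (u t))
            + ⨆ t ∈ Set.Icc (0:ℝ) T, (L2Norm (u t)) ^ 6) := by
  refine ⟨8 * π + 1, by positivity, fun T hT u hu => ?_⟩
  have h := hu.nlsPair
  have hs := contDiff_slice hu.1
  have h0 : (0 : ℝ) ∈ Set.Icc 0 T := ⟨le_rfl, hT.le⟩
  obtain ⟨K, hK⟩ := h.exists_bound hT.le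
  have hgK : ∀ t ∈ Set.Icc 0 T, (2 * π * HdotNorm 1 (u t)) ^ 2 ≤ K := by
    intro t ht
    rw [← (hu.2.1 t ht).integral_gradDens_parts hs]
    exact (integral_mono (h.int_grad ht) (h.int_mass_grad ht)
      fun x => le_add_of_nonneg_left (massDens_nonneg _ _ _ _)).trans (hK t ht)
  have hK0 : 0 ≤ K := (sq_nonneg _).trans (hgK 0 h0)
  have hHK : ∀ t ∈ Set.Icc 0 T, 2 * π * HdotNorm 1 (u t) ≤ √K :=
    fun t ht => Real.le_sqrt_of_sq_le (hgK t ht)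
  set L := L2Norm (u 0) with hL
  have hL0 : 0 ≤ L := L2Norm_nonneg _
  have hLt : ∀ t ∈ Set.Icc 0 T, L2Norm (u t) = L := by
    intro t ht
    have h1 := h.mass_le_of_bound subset_rfl hK h0 ht
    have h2 := h.mass_le_of_bound subset_rfl hK ht h0
    rw [integral_massDens_parts, integral_massDens_parts] at h1 h2
    exact (sq_eq_sq₀ (L2Norm_nonneg _) hL0).1 (le_antisymm h1 h2)
  have hm : ∀ t ∈ Set.Icc 0 T, ∫ x, massDens (rePart u) (imPart u) t x ≤ L ^ 2 := by
    intro t ht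
    rw [integral_massDens_parts, hLt t ht]
  set A := ⨆ t ∈ Set.Icc (0:ℝ) T, (L2Norm (u t)) ^ 5 * HdotNorm 1 (u t) with hA
  set B := ⨆ t ∈ Set.Icc (0:ℝ) T, (L2Norm (u t)) ^ 6 with hB
  have hA' : ∀ t ∈ Set.Icc (0:ℝ) T, (L2Norm (u t)) ^ 5 * HdotNorm 1 (u t) ≤ A := fun t ht =>
    le_biSup_of_nonneg (f := fun t => (L2Norm (u t)) ^ 5 * HdotNorm 1 (u t))
      (B := L ^ 5 * (√K / (2 * π)))
      (fun t _ => mul_nonneg (pow_nonneg (L2Norm_nonneg _) 5) (HdotNorm_nonneg _ _))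
      (fun t ht => by
        rw [hLt t ht]
        refine mul_le_mul_of_nonneg_left ?_ (pow_nonneg hL0 5)
        rw [le_div_iff₀' (by positivity)]
        exact hHK t ht) ht
  have hB' : L ^ 6 ≤ B :=
    le_biSup_of_nonneg (f := fun t => (L2Norm (u t)) ^ 6) (B := L ^ 6)
      (fun t _ => pow_nonneg (L2Norm_nonneg _) 6)
      (fun t ht => by rw [hLt t ht]) h0
  have hA0 : 0 ≤ A := le_trans
    (mul_nonneg (pow_nonneg (L2Norm_nonneg _) 5) (HdotNorm_nonneg _ _)) (hA' 0 h0)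
  have hB0 : 0 ≤ B := le_trans (pow_nonneg hL0 6) hB'
  obtain ⟨G, hG0, hG, hLG⟩ : ∃ G : ℝ, 0 ≤ G ∧
      (∀ t ∈ Set.Icc 0 T, 2 * π * HdotNorm 1 (u t) ≤ G) ∧ L ^ 5 * G ≤ 2 * π * A := by
    rcases hL0.eq_or_lt with hL1 | hL1
    · refine ⟨√K, Real.sqrt_nonneg _, hHK, ?_⟩
      rw [← hL1, zero_pow (by norm_num), zero_mul]
      positivity
    · refine ⟨2 * π * A / L ^ 5, by positivity, fun t ht => ?_, ?_⟩
      · have := hA' t ht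
        rw [hLt t ht] at this
        rw [le_div_iff₀ (by positivity)]
        nlinarith [Real.pi_pos]
      · rw [mul_div_cancel₀ _ (by positivity)]
  have key := h.integral_integral_mass_cube_le_rpow hT hL0 hm (G := G) (fun t ht => by
    rw [(hu.2.1 t ht).integral_gradDens_parts hs]
    exact pow_le_pow_left₀ (mul_nonneg (by positivity) (HdotNorm_nonneg _ _)) (hG t ht) 2) hG0
  simp_rw [integral_massDens_cube_parts] at key
  refine key.trans ?_
  rw [mul_comm (8 * π + 1), mul_assoc]
  refine mul_le_mul_of_nonneg_left ?_ (Real.rpow_nonneg hT.le _)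
  nlinarith [mul_nonneg Real.pi_pos.le hB0]

end
end
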